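/- arXiv:2605.07198 — 11 statements merged into one kernel-verified Lean document; each statement's English description precedes it below -/
import Mathlib

section
/- Let s > 0 and c = 2/√s. Then there exists a positive unbounded traveling wave of speed c for u_t = u_xx + u³/(1+s u²): a twice differentiable function φ : ℝ → ℝ with φ(ξ) > 0 for all ξ, satisfying φ''(ξ) + c·φ'(ξ) + φ(ξ)³/(1 + s·φ(ξ)²) = 0 for all ξ, which is strictly decreasing (φ'(ξ) < 0 for all ξ) and satisfies φ(ξ) → +∞ as ξ → -∞ and φ(ξ) → 0 as ξ → +∞. -/
open Filter

open scoped BoundedContinuousFunction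

namespace TW

/-- The primitive from `-∞`. -/
noncomputable def F (f : ℝ → ℝ) (t : ℝ) : ℝ := ∫ r in Set.Iic t, Real.exp (2 * r) * f r

lemma int_exp (t : ℝ) : MeasureTheory.IntegrableOn (fun r => Real.exp (2 * r)) (Set.Iic t) :=
  integrableOn_exp_mul_Iic (by norm_num) t

lemma int_exp_val (t : ℝ) : ∫ r in Set.Iic t, Real.exp (2 * r) = Real.exp (2 * t) / 2 :=
  integral_exp_mul_Iic (by norm_num) t

lemma int_F (f : ℝ → ℝ) (hf : Continuous f) (C : ℝ) (hC : ∀ x, |f x| ≤ C) (t : ℝ) :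
    MeasureTheory.IntegrableOn (fun r => Real.exp (2 * r) * f r) (Set.Iic t) := by
  refine MeasureTheory.Integrable.mono' ((int_exp t).mul_const C) ?_ ?_
  · exact (by fun_prop : Continuous fun r => Real.exp (2 * r) * f r).aestronglyMeasurable
  · refine Eventually.of_forall fun r => ?_
    rw [Real.norm_eq_abs, abs_mul, abs_of_pos (Real.exp_pos _)]
    exact mul_le_mul_of_nonneg_left (hC r) (Real.exp_pos _).le

lemma F_bound (f : ℝ → ℝ) (C : ℝ) (hC : ∀ x, |f x| ≤ C) (t : ℝ) :
    |F f t| ≤ Real.exp (2 * t) * (C / 2) := by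
  have h := MeasureTheory.norm_integral_le_of_norm_le (μ := MeasureTheory.volume.restrict (Set.Iic t))
    (f := fun r => Real.exp (2 * r) * f r) ((int_exp t).mul_const C)
    (Eventually.of_forall fun r => by
      rw [Real.norm_eq_abs, abs_mul, abs_of_pos (Real.exp_pos _)]
      exact mul_le_mul_of_nonneg_left (hC r) (Real.exp_pos _).le)
  rw [MeasureTheory.integral_mul_const, int_exp_val, Real.norm_eq_abs] at h
  unfold F
  linarith

lemma F_deriv (f : ℝ → ℝ) (hf : Continuous f) (C : ℝ) (hC : ∀ x, |f x| ≤ C) (t : ℝ) :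
    HasDerivAt (F f) (Real.exp (2 * t) * f t) t := by
  have hc : Continuous fun r => Real.exp (2 * r) * f r := by fun_prop
  have h1 : F f = fun t => F f 0 + ∫ r in (0:ℝ)..t, Real.exp (2 * r) * f r := by
    funext t
    rw [← intervalIntegral.integral_Iic_sub_Iic (int_F f hf C hC 0) (int_F f hf C hC t)]
    unfold F
    ring
  rw [h1]
  exact (intervalIntegral.integral_hasDerivAt_right (hc.intervalIntegrable _ _)
    (hc.stronglyMeasurableAtFilter _ _) hc.continuousAt).const_add _

noncomputable def S (f : ℝ → ℝ) (t : ℝ) : ℝ := Real.exp (-2 * t) * F f t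

lemma exp_cancel (t : ℝ) : Real.exp (-2 * t) * Real.exp (2 * t) = 1 := by
  rw [← Real.exp_add]; simp

lemma S_bound (f : ℝ → ℝ) (C : ℝ) (hC : ∀ x, |f x| ≤ C) (t : ℝ) : |S f t| ≤ C / 2 := by
  unfold S
  rw [abs_mul, abs_of_pos (Real.exp_pos _)]
  calc _ ≤ Real.exp (-2 * t) * (Real.exp (2 * t) * (C / 2)) :=
        mul_le_mul_of_nonneg_left (F_bound f C hC t) (Real.exp_pos _).le
    _ = _ := by rw [← mul_assoc, exp_cancel, one_mul]

lemma S_deriv (f : ℝ → ℝ) (hf : Continuous f) (C : ℝ) (hC : ∀ x, |f x| ≤ C) (t : ℝ) :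
    HasDerivAt (S f) (f t - 2 * S f t) t := by
  have h1 : HasDerivAt (fun t : ℝ => Real.exp (-2 * t)) (Real.exp (-2 * t) * (-2)) t := by
    simpa using ((hasDerivAt_id t).const_mul (-2)).exp
  refine (h1.mul (F_deriv f hf C hC t)).congr_deriv ?_
  unfold S
  linear_combination (f t) * exp_cancel t

lemma S_cont (f : ℝ → ℝ) (hf : Continuous f) (C : ℝ) (hC : ∀ x, |f x| ≤ C) :
    Continuous (S f) :=
  continuous_iff_continuousAt.2 fun t => (S_deriv f hf C hC t).continuousAt

lemma S_sub (f g : ℝ → ℝ) (hf : Continuous f) (hg : Continuous g) (C D : ℝ)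
    (hC : ∀ x, |f x| ≤ C) (hD : ∀ x, |g x| ≤ D) (t : ℝ) :
    S f t - S g t = S (fun x => f x - g x) t := by
  unfold S F
  rw [← mul_sub, ← MeasureTheory.integral_sub (int_F f hf C hC t) (int_F g hg D hD t)]
  simp only [mul_sub]

lemma S_nonneg (f : ℝ → ℝ) (hf : ∀ x, 0 ≤ f x) (t : ℝ) : 0 ≤ S f t := by
  unfold S F
  refine mul_nonneg (Real.exp_pos _).le (MeasureTheory.integral_nonneg fun r => ?_)
  exact mul_nonneg (Real.exp_pos _).le (hf r)

noncomputable def h (t y : ℝ) : ℝ :=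
  (1 + Real.exp (2 * t) * max y 0) / (Real.exp (2 * t) + (1 + Real.exp (2 * t) * max y 0) ^ 2)

lemma h_nonneg (t y : ℝ) : 0 ≤ h t y := by
  unfold h
  have : 0 ≤ max y 0 := le_max_right _ _
  positivity

lemma h_le (t y : ℝ) : |h t y| ≤ 1 := by
  rw [abs_of_nonneg (h_nonneg t y)]
  unfold h
  have h1 : 0 ≤ max y 0 := le_max_right _ _
  have h2 := Real.exp_pos (2 * t)
  rw [div_le_one (by positivity)]
  have : 0 ≤ Real.exp (2 * t) * max y 0 := by positivity
  nlinarith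

lemma h_lip (t y y' : ℝ) : |h t y - h t y'| ≤ |y - y'| := by
  refine le_trans ?_ (abs_max_sub_max_le_abs y y' 0)
  unfold h
  have h1 : 0 ≤ max y 0 := le_max_right _ _
  have h1' : 0 ≤ max y' 0 := le_max_right _ _
  have h2 := Real.exp_pos (2 * t)
  generalize max y 0 = p at *
  generalize max y' 0 = q at *
  generalize Real.exp (2 * t) = a at *
  have hz : 0 < 1 + a * p := by positivity
  have hw : 0 < 1 + a * q := by positivity
  have hA : 0 < a + (1 + a * p) ^ 2 := by positivity
  have hB : 0 < a + (1 + a * q) ^ 2 := by positivity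
  have e : (1 + a * p) / (a + (1 + a * p) ^ 2) - (1 + a * q) / (a + (1 + a * q) ^ 2)
      = (p - q) * (a * (a - (1 + a * p) * (1 + a * q)) /
        ((a + (1 + a * p) ^ 2) * (a + (1 + a * q) ^ 2))) := by
    field_simp
    ring
  rw [e, abs_mul]
  refine mul_le_of_le_one_right (abs_nonneg _) ?_
  rw [abs_div, abs_of_pos (mul_pos hA hB), div_le_one (mul_pos hA hB), abs_le]
  generalize 1 + a * p = z at *
  generalize 1 + a * q = w at *
  have := mul_pos hz hw
  have := mul_pos h2 this
  constructor
  · nlinarith [mul_nonneg h2.le (sq_nonneg (z - w)), sq_nonneg (z * w), sq_nonneg a]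
  · nlinarith [mul_nonneg h2.le (sq_nonneg (z - w)), sq_nonneg (z * w), sq_nonneg a,
      mul_nonneg h2.le (add_nonneg (sq_nonneg z) (sq_nonneg w))]

lemma h_cont (y : ℝ → ℝ) (hy : Continuous y) : Continuous fun t => h t (y t) := by
  unfold h
  refine Continuous.div (by fun_prop) (by fun_prop) fun t => ?_
  have := Real.exp_pos (2 * t)
  positivity

lemma Sh_cont (y : ℝ → ℝ) (hy : Continuous y) : Continuous (S fun t => h t (y t)) :=
  S_cont _ (h_cont y hy) 1 fun _ => h_le _ _

lemma Sh_bound (y : ℝ → ℝ) (t : ℝ) : |S (fun t => h t (y t)) t| ≤ 1 / 2 :=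
  S_bound _ 1 (fun _ => h_le _ _) t

noncomputable def T (y : ℝ →ᵇ ℝ) : ℝ →ᵇ ℝ :=
  BoundedContinuousFunction.ofNormedAddCommGroup (S (S fun t => h t (y t)))
    (S_cont _ (Sh_cont y y.continuous) (1 / 2) (Sh_bound y)) (1 / 2 / 2)
    (fun t => S_bound _ (1 / 2) (Sh_bound y) t)

lemma T_apply (y : ℝ →ᵇ ℝ) (t : ℝ) : T y t = S (S fun t => h t (y t)) t := rfl

lemma T_contr : ContractingWith (1 / 4) T := by
  refine ⟨by rw [← NNReal.coe_lt_coe]; norm_num, LipschitzWith.of_dist_le_mul fun y y' => ?_⟩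
  rw [BoundedContinuousFunction.dist_le (by positivity)]
  intro t
  rw [Real.dist_eq, T_apply, T_apply,
    S_sub _ _ (Sh_cont y y.continuous) (Sh_cont y' y'.continuous) _ _ (Sh_bound y) (Sh_bound y')]
  have hb : ∀ x, |S (fun t => h t (y t)) x - S (fun t => h t (y' t)) x| ≤ dist y y' / 2 := by
    intro x
    rw [S_sub _ _ (h_cont y y.continuous) (h_cont y' y'.continuous) 1 1
      (fun _ => h_le _ _) (fun _ => h_le _ _)]
    refine S_bound _ _ (fun r => ?_) x
    refine (h_lip _ _ _).trans ?_
    rw [← Real.dist_eq]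
    exact BoundedContinuousFunction.dist_coe_le_dist r
  refine (S_bound _ _ hb t).trans (le_of_eq ?_)
  push_cast
  ring

lemma exists_yu : ∃ y u : ℝ → ℝ, (∀ t, 0 ≤ y t) ∧ (∀ t, 0 ≤ u t) ∧ (∀ t, u t ≤ 1 / 2) ∧
    (∀ t, HasDerivAt y (u t - 2 * y t) t) ∧
    (∀ t, HasDerivAt u ((1 + Real.exp (2 * t) * y t) /
      (Real.exp (2 * t) + (1 + Real.exp (2 * t) * y t) ^ 2) - 2 * u t) t) := by
  obtain ⟨y, hy⟩ : ∃ y, T y = y := ⟨_, T_contr.fixedPoint_isFixedPt⟩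
  have hu0 : ∀ t, 0 ≤ S (fun t => h t (y t)) t := S_nonneg _ fun _ => h_nonneg _ _
  have hyS : (y : ℝ → ℝ) = S (S fun t => h t (y t)) := by
    funext t; rw [← T_apply, hy]
  have hy0 : ∀ t, 0 ≤ y t := fun t => by rw [hyS]; exact S_nonneg _ hu0 t
  refine ⟨y, S (fun t => h t (y t)), hy0, hu0, fun t => (abs_le.1 (Sh_bound y t)).2, ?_, ?_⟩
  · intro t
    have := S_deriv _ (Sh_cont y y.continuous) _ (Sh_bound y) t
    rwa [← hyS] at this
  · intro t
    have := S_deriv _ (h_cont y y.continuous) 1 (fun _ => h_le _ _) t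
    have e : h t (y t) = (1 + Real.exp (2 * t) * y t) /
      (Real.exp (2 * t) + (1 + Real.exp (2 * t) * y t) ^ 2) := by
      unfold h; rw [max_eq_left (hy0 t)]
    rwa [e] at this

lemma exists_v : ∃ v p : ℝ → ℝ, (∀ t, HasDerivAt v (p t) t) ∧
    (∀ t, HasDerivAt p (-2 * p t - v t ^ 3 / (1 + v t ^ 2)) t) ∧
    (∀ t, Real.exp (-t) ≤ v t) ∧ (∀ t, 0 ≤ p t + v t) ∧ (∀ t ≤ 0, p t < 0) := by
  obtain ⟨y, u, hy0, hu0, hu1, hy, hu⟩ := exists_yu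
  have hE : ∀ t : ℝ, HasDerivAt (fun t : ℝ => Real.exp (-t)) (-Real.exp (-t)) t := fun t => by
    simpa using (hasDerivAt_neg t).exp
  have hee : ∀ t : ℝ, Real.exp (-t) * Real.exp t = 1 := fun t => by
    rw [← Real.exp_add]; simp
  have he2 : ∀ t : ℝ, Real.exp (2 * t) = Real.exp t * Real.exp t := fun t => by
    rw [← Real.exp_add]; ring_nf
  have hv : ∀ t, HasDerivAt (fun t => Real.exp (-t) + Real.exp t * y t)
      (Real.exp t * u t - (Real.exp (-t) + Real.exp t * y t)) t := fun t => by
    refine ((hE t).add ((Real.hasDerivAt_exp t).mul (hy t))).congr_deriv ?_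
    ring
  refine ⟨fun t => Real.exp (-t) + Real.exp t * y t,
    fun t => Real.exp t * u t - (Real.exp (-t) + Real.exp t * y t), hv, ?_, ?_, ?_, ?_⟩
  · intro t
    refine (((Real.hasDerivAt_exp t).mul (hu t)).sub (hv t)).congr_deriv ?_
    have h1 := hee t
    have h2 := he2 t
    have h3 := Real.exp_pos t
    have h4 := Real.exp_pos (-t)
    have h5 := hy0 t
    simp only [h2]
    generalize Real.exp t = a at *
    generalize y t = Y at *
    have hb : Real.exp (-t) = 1 / a := by field_simp; exact h1
    rw [hb]
    have hz : 0 < 1 + a * a * Y := by positivity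
    have e : 1 / a + a * Y = (1 + a * a * Y) / a := by field_simp
    rw [e]
    generalize 1 + a * a * Y = z at *
    have : a * a + z ^ 2 ≠ 0 := by positivity
    have : 1 + (z / a) ^ 2 ≠ 0 := by positivity
    have : a ^ 2 + z ^ 2 ≠ 0 := by positivity
    field_simp
    ring
  · intro t
    have := mul_nonneg (Real.exp_pos t).le (hy0 t)
    simp only
    linarith
  · intro t
    have := mul_nonneg (Real.exp_pos t).le (hu0 t)
    simp only
    linarith
  · intro t ht
    have h1 := mul_nonneg (Real.exp_pos t).le (hy0 t)
    have h2 := mul_le_mul_of_nonneg_left (hu1 t) (Real.exp_pos t).le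
    have h3 : Real.exp t ≤ 1 := Real.exp_le_one_iff.2 ht
    have h4 : 1 ≤ Real.exp (-t) := Real.one_le_exp (by linarith)
    simp only
    linarith

lemma exists_v' : ∃ v p : ℝ → ℝ, (∀ t, HasDerivAt v (p t) t) ∧
    (∀ t, HasDerivAt p (-2 * p t - v t ^ 3 / (1 + v t ^ 2)) t) ∧
    (∀ t, 0 < v t) ∧ (∀ t, p t < 0) ∧ Tendsto v atBot atTop ∧ Tendsto v atTop (nhds 0) := by
  obtain ⟨v, p, hv, hp, hev, hpv, hneg⟩ := exists_v
  have hpos : ∀ t, 0 < v t := fun t => (Real.exp_pos _).trans_le (hev t)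
  have hpneg : ∀ t, p t < 0 := by
    intro t
    rcases le_total t 0 with ht | ht
    · exact hneg t ht
    have hd : ∀ t, HasDerivAt (fun t => Real.exp (2 * t) * p t)
        (-(Real.exp (2 * t) * (v t ^ 3 / (1 + v t ^ 2)))) t := fun t => by
      have h1 : HasDerivAt (fun t : ℝ => Real.exp (2 * t)) (Real.exp (2 * t) * 2) t := by
        simpa using ((hasDerivAt_id t).const_mul 2).exp
      refine (h1.mul (hp t)).congr_deriv ?_
      ring
    have ha : Antitone (fun t => Real.exp (2 * t) * p t) :=
      antitone_of_hasDerivAt_nonpos hd fun t => by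
        have := hpos t
        have : 0 ≤ Real.exp (2 * t) * (v t ^ 3 / (1 + v t ^ 2)) := by positivity
        simpa using this
    have h2 := ha ht
    have h3 := hneg 0 le_rfl
    simp only [mul_zero, Real.exp_zero, one_mul] at h2
    by_contra hcon
    have := mul_nonneg (Real.exp_pos (2 * t)).le (not_lt.1 hcon)
    linarith
  have hanti : Antitone v := antitone_of_hasDerivAt_nonpos hv fun t => (hpneg t).le
  refine ⟨v, p, hv, hp, hpos, hpneg, ?_, ?_⟩
  · exact tendsto_atTop_mono hev (Real.tendsto_exp_atTop.comp tendsto_neg_atBot_atTop)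
  · rw [Metric.tendsto_atTop]
    intro ε hε
    obtain ⟨N, hN⟩ : ∃ N, v N < ε := by
      by_contra! hcon
      set k := ε ^ 3 / (1 + ε ^ 2) with hk
      have hk0 : 0 < k := by positivity
      have hkv : ∀ t, k ≤ v t ^ 3 / (1 + v t ^ 2) := by
        intro t
        rw [hk, div_le_div_iff₀ (by positivity) (by positivity)]
        have h1 := hcon t
        have h3 : ε ^ 3 ≤ v t ^ 3 := by gcongr
        have h4 : ε ^ 2 * v t ^ 2 * ε ≤ ε ^ 2 * v t ^ 2 * v t := by gcongr
        nlinarith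
      have hd : ∀ t, HasDerivAt (fun t => p t + 2 * v t + k * t)
          (-2 * p t - v t ^ 3 / (1 + v t ^ 2) + 2 * p t + k * 1) t := fun t =>
        ((hp t).add ((hv t).const_mul 2)).add ((hasDerivAt_id t).const_mul k)
      have ha : Antitone (fun t => p t + 2 * v t + k * t) :=
        antitone_of_hasDerivAt_nonpos hd fun t => by
          have := hkv t
          simp only [Pi.zero_apply]
          linarith
      have hE0 : 0 < p 0 + 2 * v 0 := by linarith [hpv 0, hpos 0]
      have h1 := ha (show 0 ≤ (p 0 + 2 * v 0) / k by positivity)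
      simp only [mul_zero, add_zero] at h1
      rw [mul_div_cancel₀ _ hk0.ne'] at h1
      linarith [hpv ((p 0 + 2 * v 0) / k), hpos ((p 0 + 2 * v 0) / k)]
    refine ⟨N, fun n hn => ?_⟩
    rw [Real.dist_eq, sub_zero, abs_of_pos (hpos n)]
    exact (hanti hn).trans_lt hN

end TW

/-- At the critical speed `c = 2/√s` there exists a positive unbounded
traveling wave of speed `c` for `u_t = u_xx + u³/(1+s u²)`, strictly decreasing
(`φ' < 0`), with `φ → +∞` at `-∞` and `φ → 0` at `+∞`. -/
theorem exists_positive_unbounded_traveling_wave_at_critical_speed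
    (s c : ℝ) (hs : 0 < s) (hc : c = 2 / Real.sqrt s) :
    ∃ φ : ℝ → ℝ,
      (∀ ξ : ℝ, DifferentiableAt ℝ φ ξ) ∧
      (∀ ξ : ℝ, DifferentiableAt ℝ (deriv φ) ξ) ∧
      (∀ ξ : ℝ, 0 < φ ξ) ∧
      (∀ ξ : ℝ, deriv (deriv φ) ξ + c * deriv φ ξ + (φ ξ) ^ 3 / (1 + s * (φ ξ) ^ 2) = 0) ∧
      (∀ ξ : ℝ, deriv φ ξ < 0) ∧
      Tendsto φ atBot atTop ∧
      Tendsto φ atTop (nhds 0) := by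
  obtain ⟨v, p, hv, hp, hpos, hneg, hbot, htop⟩ := TW.exists_v'
  obtain ⟨k, hk, hck, hsk⟩ : ∃ k : ℝ, 0 < k ∧ c = 2 * k ∧ s * k ^ 2 = 1 := by
    have h0 := Real.sqrt_pos.2 hs
    refine ⟨1 / Real.sqrt s, by positivity, by rw [hc]; ring, ?_⟩
    rw [div_pow, Real.sq_sqrt hs.le]
    field_simp
  have hl : ∀ ξ : ℝ, HasDerivAt (fun ξ => k * ξ) k ξ := fun ξ => by
    simpa using (hasDerivAt_id ξ).const_mul k
  have h1 : ∀ ξ, HasDerivAt (fun ξ => k * v (k * ξ)) (k ^ 2 * p (k * ξ)) ξ := fun ξ => by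
    refine (((hv (k * ξ)).comp ξ (hl ξ)).const_mul k).congr_deriv ?_
    ring
  have h2 : ∀ ξ, HasDerivAt (fun ξ => k ^ 2 * p (k * ξ))
      (k ^ 3 * (-2 * p (k * ξ) - v (k * ξ) ^ 3 / (1 + v (k * ξ) ^ 2))) ξ := fun ξ => by
    refine (((hp (k * ξ)).comp ξ (hl ξ)).const_mul (k ^ 2)).congr_deriv ?_
    ring
  have hd : deriv (fun ξ => k * v (k * ξ)) = fun ξ => k ^ 2 * p (k * ξ) :=
    funext fun ξ => (h1 ξ).deriv
  refine ⟨fun ξ => k * v (k * ξ), fun ξ => (h1 ξ).differentiableAt, ?_, ?_, ?_, ?_, ?_, ?_⟩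
  · rw [hd]; exact fun ξ => (h2 ξ).differentiableAt
  · exact fun ξ => mul_pos hk (hpos _)
  · intro ξ
    rw [hd, (h2 ξ).deriv, hck]
    have : s * (k * v (k * ξ)) ^ 2 = v (k * ξ) ^ 2 := by
      rw [mul_pow, ← mul_assoc, hsk, one_mul]
    simp only [this]
    ring
  · rw [hd]
    exact fun ξ => mul_neg_of_pos_of_neg (by positivity) (hneg _)
  · exact (hbot.comp (tendsto_id.const_mul_atBot hk)).const_mul_atTop hk
  · have := (htop.comp (tendsto_id.const_mul_atTop hk)).const_mul k
    rw [mul_zero] at this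
    exact this
end

section
/- Let s > 0 and c > 2/√s, and set M₋ = (-cs - √(c²s² - 4s))/(2s) and M₊ = (-cs + √(c²s² - 4s))/(2s). Then there exist two positive unbounded traveling waves φ₁, φ₂ of speed c (twice differentiable, strictly decreasing, positive solutions of φ'' + cφ' + φ³/(1+sφ²) = 0 on ℝ with φᵢ(ξ) → +∞ as ξ → -∞ and φᵢ(ξ) → 0 as ξ → +∞) of two distinct types, distinguished by their asymptotic logarithmic slopes at the unbounded end: φ₁'(ξ)/φ₁(ξ) → M₋ and φ₂'(ξ)/φ₂(ξ) → M₊ as ξ → -∞. -/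
open Filter

section Aux
open MeasureTheory Set

noncomputable def JJ (a : ℝ) (f : ℝ → ℝ) (x : ℝ) : ℝ :=
  Real.exp (-a * x) * ∫ t in Iic x, Real.exp (a * t) * f t

lemma JJ_integrable {a B : ℝ} (ha : 0 < a) {f : ℝ → ℝ} (hf : Continuous f)
    (hB : ∀ x, |f x| ≤ B) (x : ℝ) : IntegrableOn (fun t => Real.exp (a * t) * f t) (Iic x) := by
  have h1 : IntegrableOn (fun t => Real.exp (a * t) * B) (Iic x) :=
    (integrableOn_exp_mul_Iic ha x).mul_const B
  refine Integrable.mono' h1 (by fun_prop) (Eventually.of_forall fun t => ?_)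
  rw [Real.norm_eq_abs, abs_mul, Real.abs_exp]
  exact mul_le_mul_of_nonneg_left (hB t) (Real.exp_pos _).le

lemma JJ_bound {a B : ℝ} (ha : 0 < a) {f : ℝ → ℝ} 
    (hB : ∀ x, |f x| ≤ B) (x : ℝ) : |JJ a f x| ≤ B / a := by
  have h1 : IntegrableOn (fun t => Real.exp (a * t) * B) (Iic x) :=
    (integrableOn_exp_mul_Iic ha x).mul_const B
  have h2 : ‖∫ t in Iic x, Real.exp (a * t) * f t‖ ≤ ∫ t in Iic x, Real.exp (a * t) * B := by
    refine norm_integral_le_of_norm_le h1 (Eventually.of_forall fun t => ?_)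
    rw [Real.norm_eq_abs, abs_mul, Real.abs_exp]
    exact mul_le_mul_of_nonneg_left (hB t) (Real.exp_pos _).le
  rw [integral_mul_const, integral_exp_mul_Iic ha, Real.norm_eq_abs] at h2
  unfold JJ
  rw [abs_mul, Real.abs_exp]
  calc _ ≤ Real.exp (-a * x) * (Real.exp (a * x) / a * B) :=
        mul_le_mul_of_nonneg_left h2 (Real.exp_pos _).le
    _ = (Real.exp (-a * x) * Real.exp (a * x)) * (B / a) := by ring
    _ = B / a := by rw [← Real.exp_add]; simp

lemma JJ_nonneg {a : ℝ} {f : ℝ → ℝ} (hf : ∀ x, 0 ≤ f x) (x : ℝ) : 0 ≤ JJ a f x :=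
  mul_nonneg (Real.exp_pos _).le
    (integral_nonneg fun t => mul_nonneg (Real.exp_pos _).le (hf t))

lemma JJ_deriv {a B : ℝ} (ha : 0 < a) {f : ℝ → ℝ} (hf : Continuous f)
    (hB : ∀ x, |f x| ≤ B) (x : ℝ) : HasDerivAt (JJ a f) (f x - a * JJ a f x) x := by
  have hi := JJ_integrable ha hf hB
  have hc : Continuous fun t => Real.exp (a * t) * f t := by fun_prop
  have h1 : (fun x => ∫ t in Iic x, Real.exp (a * t) * f t) =
      fun x => (∫ t in Iic 0, Real.exp (a * t) * f t) + ∫ t in (0:ℝ)..x, Real.exp (a * t) * f t := by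
    funext y
    rw [← intervalIntegral.integral_Iic_sub_Iic (hi 0) (hi y)]; ring
  have h2 : HasDerivAt (fun x => ∫ t in Iic x, Real.exp (a * t) * f t) (Real.exp (a * x) * f x) x := by
    rw [h1]
    exact (hc.integral_hasStrictDerivAt 0 x).hasDerivAt.const_add _
  have h3 : HasDerivAt (fun x => Real.exp (-a * x)) (Real.exp (-a * x) * (-a)) x := by
    simpa using ((hasDerivAt_id x).const_mul (-a)).exp
  have h4 := h3.mul h2
  refine h4.congr_deriv ?_
  have : Real.exp (-a * x) * Real.exp (a * x) = 1 := by rw [← Real.exp_add]; simp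
  unfold JJ
  linear_combination f x * this

lemma JJ_sub {a B C : ℝ} (ha : 0 < a) {f g : ℝ → ℝ} (hf : Continuous f)
    (hB : ∀ x, |f x| ≤ B) (hg : Continuous g) (hC : ∀ x, |g x| ≤ C) (x : ℝ) :
    JJ a f x - JJ a g x = JJ a (fun t => f t - g t) x := by
  unfold JJ
  rw [← mul_sub, ← integral_sub (JJ_integrable ha hf hB x) (JJ_integrable ha hg hC x)]
  simp only [mul_sub]

noncomputable def rr (s u : ℝ) : ℝ := u / (s * (1 + s * u ^ 2))

lemma rr_lip {s : ℝ} (hs : 0 < s) (x y : ℝ) : |rr s x - rr s y| ≤ |x - y| / s := by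
  have hx : 0 < 1 + s * x ^ 2 := by positivity
  have hy : 0 < 1 + s * y ^ 2 := by positivity
  have e : rr s x - rr s y = (x - y) / s * ((1 - s * x * y) / ((1 + s * x ^ 2) * (1 + s * y ^ 2))) := by
    unfold rr; field_simp; ring
  have h : |(1 - s * x * y) / ((1 + s * x ^ 2) * (1 + s * y ^ 2))| ≤ 1 := by
    rw [abs_div, abs_of_pos (mul_pos hx hy), div_le_one (mul_pos hx hy), abs_le]
    have h0 : 0 ≤ s * x ^ 2 * (s * y ^ 2) := by positivity
    have h1 : 0 ≤ s * (x - y) ^ 2 := by positivity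
    have h2 : 0 ≤ s * (x + y) ^ 2 := by positivity
    have h3 : 0 ≤ s * x ^ 2 := by positivity
    have h4 : 0 ≤ s * y ^ 2 := by positivity
    constructor <;> nlinarith
  rw [e, abs_mul, abs_div, abs_of_pos hs]
  exact mul_le_of_le_one_right (by positivity) h

noncomputable def RR (s l x v : ℝ) : ℝ :=
  Real.exp (-l * x) * rr s (Real.exp (-l * x) + Real.exp (l * x) * |v|)

lemma RR_nonneg {s : ℝ} (hs : 0 < s) (l x v : ℝ) : 0 ≤ RR s l x v := by
  unfold RR rr; positivity

lemma RR_bound {s : ℝ} (hs : 0 < s) (l x v : ℝ) : |RR s l x v| ≤ 1 / s ^ 2 := by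
  rw [abs_of_nonneg (RR_nonneg hs l x v)]
  unfold RR rr
  have h1 : Real.exp (-l * x) ≤ Real.exp (-l * x) + Real.exp (l * x) * |v| := by
    have : 0 ≤ Real.exp (l * x) * |v| := by positivity
    linarith
  generalize Real.exp (-l * x) + Real.exp (l * x) * |v| = u at *
  have h0 := Real.exp_pos (-l * x)
  have hu : 0 < u := by linarith
  rw [← mul_div_assoc, div_le_div_iff₀ (by positivity) (by positivity)]
  nlinarith [mul_le_mul_of_nonneg_right h1 (by positivity : 0 ≤ u * s ^ 2)]

lemma RR_lip {s : ℝ} (hs : 0 < s) (l x v w : ℝ) : |RR s l x v - RR s l x w| ≤ |v - w| / s := by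
  unfold RR
  rw [← mul_sub, abs_mul, Real.abs_exp]
  have e : Real.exp (-l * x) * Real.exp (l * x) = 1 := by rw [← Real.exp_add]; simp
  calc _ ≤ Real.exp (-l * x) * (|(Real.exp (-l * x) + Real.exp (l * x) * |v|) - (Real.exp (-l * x) + Real.exp (l * x) * |w|)| / s) :=
        mul_le_mul_of_nonneg_left (rr_lip hs _ _) (Real.exp_pos _).le
    _ = (Real.exp (-l * x) * Real.exp (l * x)) * (|(|v| - |w|)| / s) := by
        rw [add_sub_add_left_eq_sub, ← mul_sub, abs_mul, Real.abs_exp]; ring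
    _ ≤ |v - w| / s := by
        rw [e, one_mul]
        exact div_le_div_of_nonneg_right (abs_abs_sub_abs_le _ _) hs.le

lemma RR_cont {s : ℝ} (hs : 0 < s) (l : ℝ) {v : ℝ → ℝ} (hv : Continuous v) :
    Continuous fun x => RR s l x (v x) := by
  unfold RR rr
  refine Continuous.mul (by fun_prop) (Continuous.div (by fun_prop) (by fun_prop) fun x => ?_)
  positivity

lemma JJ_cont {a B : ℝ} (ha : 0 < a) {f : ℝ → ℝ} (hf : Continuous f)
    (hB : ∀ x, |f x| ≤ B) : Continuous (JJ a f) :=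
  continuous_iff_continuousAt.2 fun x => (JJ_deriv ha hf hB x).continuousAt

lemma exists_fix {s l p q : ℝ} (hs : 0 < s) (hl : 0 < l) (hp : 0 < p) (hq : 0 < q)
    (hpq : s * p * q = 1) : ∃ v : ℝ → ℝ, Continuous v ∧
      v = JJ (l + p) (JJ (l + q) (fun x => RR s l x (v x))) := by
  have ha : 0 < l + p := by linarith
  have hb : 0 < l + q := by linarith
  have c0 (v : BoundedContinuousFunction ℝ ℝ) := RR_cont hs l v.continuous
  have b0 (v : BoundedContinuousFunction ℝ ℝ) (x : ℝ) := RR_bound hs l x (v x)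
  have c1 (v : BoundedContinuousFunction ℝ ℝ) := JJ_cont hb (c0 v) (b0 v)
  have b1 (v : BoundedContinuousFunction ℝ ℝ) := JJ_bound hb (b0 v)
  have c2 (v : BoundedContinuousFunction ℝ ℝ) := JJ_cont ha (c1 v) (b1 v)
  have b2 (v : BoundedContinuousFunction ℝ ℝ) := JJ_bound ha (b1 v)
  let T : BoundedContinuousFunction ℝ ℝ → BoundedContinuousFunction ℝ ℝ := fun v =>
    BoundedContinuousFunction.ofNormedAddCommGroup
      (JJ (l + p) (JJ (l + q) (fun x => RR s l x (v x)))) (c2 v) _ (b2 v)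
  have hK0 : 0 ≤ 1 / (s * (l + p) * (l + q)) := by positivity
  have hT : ContractingWith (Real.toNNReal (1 / (s * (l + p) * (l + q)))) T := by
    constructor
    · rw [Real.toNNReal_lt_one, div_lt_one (by positivity)]
      have : 0 < s * (l * l + l * p + l * q) := by positivity
      nlinarith
    · refine LipschitzWith.of_dist_le_mul fun v w => ?_
      rw [Real.coe_toNNReal _ hK0, BoundedContinuousFunction.dist_le (by positivity)]
      intro x
      rw [Real.dist_eq]
      change |JJ _ _ x - JJ _ _ x| ≤ _
      rw [JJ_sub ha (c1 v) (b1 v) (c1 w) (b1 w)]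
      refine (JJ_bound ha (B := dist v w / s / (l + q)) (fun y => ?_) x).trans (le_of_eq ?_)
      · rw [JJ_sub hb (c0 v) (b0 v) (c0 w) (b0 w)]
        refine JJ_bound hb (fun z => (RR_lip hs l z _ _).trans ?_) y
        have hd : dist (v z) (w z) ≤ dist v w := BoundedContinuousFunction.dist_coe_le_dist z
        rw [Real.dist_eq] at hd
        exact div_le_div_of_nonneg_right hd hs.le
      · field_simp
  obtain ⟨f, hf⟩ : ∃ f, T f = f := ⟨_, hT.fixedPoint_isFixedPt⟩
  refine ⟨f, f.continuous, ?_⟩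
  exact (congrArg (fun f : BoundedContinuousFunction ℝ ℝ => (f : ℝ → ℝ)) hf).symm

lemma exists_wave {s l p q : ℝ} (hs : 0 < s) (hp : 0 < p) (hq : 0 < q)
    (hpq : s * p * q = 1) (hl : l = p ∨ l = q) : ∃ φ : ℝ → ℝ,
      ((∀ ξ : ℝ, DifferentiableAt ℝ φ ξ) ∧
       (∀ ξ : ℝ, DifferentiableAt ℝ (deriv φ) ξ) ∧
       (∀ ξ : ℝ, 0 < φ ξ) ∧
       (∀ ξ : ℝ, deriv (deriv φ) ξ + (p + q) * deriv φ ξ + (φ ξ) ^ 3 / (1 + s * (φ ξ) ^ 2) = 0) ∧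
       StrictAnti φ ∧
       Tendsto φ atBot atTop ∧
       Tendsto φ atTop (nhds 0)) ∧
      Tendsto (fun ξ => deriv φ ξ / φ ξ) atBot (nhds (-l)) := by
  have hl0 : 0 < l := by rcases hl with h | h <;> rw [h] <;> assumption
  have hlc : l ≤ p + q := by rcases hl with h | h <;> linarith
  have hlr : l ^ 2 - (p + q) * l + p * q = 0 := by rcases hl with h | h <;> rw [h] <;> ring
  obtain ⟨v, hvc, hv⟩ := exists_fix hs hl0 hp hq hpq
  have ha : 0 < l + p := by linarith
  have hb : 0 < l + q := by linarith
  have c0 := RR_cont hs l hvc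
  have b0 (x : ℝ) := RR_bound hs l x (v x)
  have n0 (x : ℝ) := RR_nonneg hs l x (v x)
  have c1 := JJ_cont hb c0 b0
  have b1 := JJ_bound hb b0
  have n1 := JJ_nonneg (a := l + q) n0
  have d1 := JJ_deriv hb c0 b0
  have b2 := JJ_bound ha b1
  have n2 := JJ_nonneg (a := l + p) n1
  have d2 := JJ_deriv ha c1 b1
  rw [← hv] at b2 n2 d2
  set u := JJ (l + q) (fun x => RR s l x (v x)) with hu
  set φ : ℝ → ℝ := fun x => Real.exp (-l * x) + Real.exp (l * x) * v x with hφ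
  set ψ : ℝ → ℝ := fun x => -l * Real.exp (-l * x) + Real.exp (l * x) * (u x - p * v x) with hψ
  have hpos : ∀ x, 0 < φ x := fun x =>
    add_pos_of_pos_of_nonneg (Real.exp_pos _) (mul_nonneg (Real.exp_pos _).le (n2 x))
  have e1 (k x : ℝ) : HasDerivAt (fun x => Real.exp (k * x)) (k * Real.exp (k * x)) x := by
    simpa [mul_comm] using ((hasDerivAt_id x).const_mul k).exp
  have ee (x : ℝ) : Real.exp (l * x) * Real.exp (-l * x) = 1 := by rw [← Real.exp_add]; simp
  have hRR (x : ℝ) : Real.exp (l * x) * RR s l x (v x) = φ x / s - φ x ^ 3 / (1 + s * φ x ^ 2) := by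
    have h1 : 0 < 1 + s * φ x ^ 2 := by positivity
    unfold RR
    rw [abs_of_nonneg (n2 x), ← mul_assoc, ee, one_mul]
    change rr s (φ x) = _
    unfold rr
    field_simp
    ring
  have dφ (x : ℝ) : HasDerivAt φ (ψ x) x := by
    refine ((e1 (-l) x).add ((e1 l x).mul (d2 x))).congr_deriv ?_
    simp only [hψ]; ring
  have dψ (x : ℝ) : HasDerivAt ψ (-(p + q) * ψ x - φ x ^ 3 / (1 + s * φ x ^ 2)) x := by
    refine (((e1 (-l) x).const_mul (-l)).add
      ((e1 l x).mul ((d1 x).sub ((d2 x).const_mul p)))).congr_deriv ?_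
    have h1 : p * q = 1 / s := by field_simp; linarith
    have h2 : φ x ^ 3 / (1 + s * φ x ^ 2) = p * q * φ x - Real.exp (l * x) * RR s l x (v x) := by
      rw [hRR, h1]; ring
    rw [h2]
    simp only [hψ, hφ, Pi.sub_apply]
    linear_combination Real.exp (-l * x) * hlr
  have hder : deriv φ = ψ := funext fun x => (dφ x).deriv
  have hder2 (x : ℝ) := (dψ x).deriv
  have g0 (x : ℝ) : 0 < φ x ^ 3 / (1 + s * φ x ^ 2) := by have := hpos x; positivity
  -- limits at minus infinity
  have tE : Tendsto (fun x : ℝ => Real.exp (l * x)) atBot (nhds 0) :=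
    Real.tendsto_exp_atBot.comp (tendsto_id.const_mul_atBot hl0)
  have tE2 : Tendsto (fun x : ℝ => Real.exp (l * x) * Real.exp (l * x)) atBot (nhds 0) := by
    simpa using tE.mul tE
  have tv : Tendsto (fun x : ℝ => Real.exp (l * x) * Real.exp (l * x) * v x) atBot (nhds 0) :=
    tE2.zero_mul_isBoundedUnder_le (isBoundedUnder_of ⟨_, b2⟩)
  have tu : Tendsto (fun x : ℝ => Real.exp (l * x) * Real.exp (l * x) * u x) atBot (nhds 0) :=
    tE2.zero_mul_isBoundedUnder_le (isBoundedUnder_of ⟨_, b1⟩)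
  have tq : Tendsto (fun ξ => ψ ξ / φ ξ) atBot (nhds (-l)) := by
    have h : Tendsto (fun x => (-l + (Real.exp (l * x) * Real.exp (l * x) * u x
        - p * (Real.exp (l * x) * Real.exp (l * x) * v x))) /
        (1 + Real.exp (l * x) * Real.exp (l * x) * v x)) atBot
        (nhds ((-l + (0 - p * 0)) / (1 + 0))) :=
      (tendsto_const_nhds.add (tu.sub (tv.const_mul p))).div (tendsto_const_nhds.add tv) (by norm_num)
    have e : (-l + (0 - p * 0)) / (1 + 0) = -l := by ring
    rw [e] at h
    refine h.congr fun x => ?_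
    have h1 : (1 + Real.exp (l * x) * Real.exp (l * x) * v x) = Real.exp (l * x) * φ x := by
      simp only [hφ]; linear_combination - ee x
    have h2 : (-l + (Real.exp (l * x) * Real.exp (l * x) * u x
        - p * (Real.exp (l * x) * Real.exp (l * x) * v x))) = Real.exp (l * x) * ψ x := by
      simp only [hψ]; linear_combination l * ee x
    rw [h1, h2, mul_div_mul_left _ _ (Real.exp_pos _).ne']
  have tφ : Tendsto φ atBot atTop := by
    refine tendsto_atTop_mono (f := fun x => Real.exp (-l * x)) (fun x => ?_)
      (Real.tendsto_exp_atTop.comp (tendsto_id.const_mul_atBot_of_neg (by linarith)))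
    have := mul_nonneg (Real.exp_pos (l * x)).le (n2 x)
    simp only [hφ]; linarith
  -- negativity of the slope
  have hW : StrictAnti fun x => Real.exp ((p + q) * x) * ψ x := by
    refine strictAnti_of_deriv_neg fun x => ?_
    have h1 := ((e1 (p + q) x).mul (dψ x)).deriv
    have h2 := mul_pos (Real.exp_pos ((p + q) * x)) (g0 x)
    calc _ = _ := h1
      _ < 0 := by linarith
  have hneg (x : ℝ) : ψ x < 0 := by
    have h1 : ∀ᶠ y in atBot, ψ y / φ y < 0 := tq.eventually_lt_const (by linarith)
    obtain ⟨y, hy1, hy2⟩ := (h1.and (eventually_le_atBot x)).exists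
    have h2 : ψ y < 0 := by
      by_contra hcon
      exact absurd (div_nonneg (not_lt.1 hcon) (hpos y).le) (not_le.2 hy1)
    have h3 := hW.antitone hy2
    have h4 : Real.exp ((p + q) * y) * ψ y < 0 := mul_neg_of_pos_of_neg (Real.exp_pos _) h2
    have h5 : Real.exp ((p + q) * x) * ψ x < 0 := lt_of_le_of_lt h3 h4
    exact (pos_iff_neg_of_mul_neg h5).1 (Real.exp_pos _)
  have hanti : StrictAnti φ := strictAnti_of_deriv_neg fun x => by rw [hder]; exact hneg x
  -- limit at plus infinity
  have hG (x : ℝ) : 0 ≤ ψ x + (p + q) * φ x := by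
    have h1 := mul_nonneg (Real.exp_pos (l * x)).le (n2 x)
    have h2 := mul_nonneg (Real.exp_pos (l * x)).le (n1 x)
    have h3 := mul_nonneg (sub_nonneg.2 hlc) (Real.exp_pos (-l * x)).le
    have h4 := mul_nonneg hq.le h1
    simp only [hψ, hφ]; nlinarith
  have dG (x : ℝ) : HasDerivAt (fun x => ψ x + (p + q) * φ x) (-(φ x ^ 3 / (1 + s * φ x ^ 2))) x :=
    ((dψ x).add ((dφ x).const_mul (p + q))).congr_deriv (by ring)
  have hbd : BddBelow (range φ) := ⟨0, by rintro _ ⟨x, rfl⟩; exact (hpos x).le⟩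
  have tI := tendsto_atTop_ciInf hanti.antitone hbd
  have hI0 : 0 ≤ ⨅ x, φ x := le_ciInf fun x => (hpos x).le
  have hI : ⨅ x, φ x = 0 := by
    by_contra hne
    have hLpos : 0 < ⨅ x, φ x := lt_of_le_of_ne hI0 (Ne.symm hne)
    have hLle (x : ℝ) : (⨅ x, φ x) ≤ φ x := ciInf_le hbd x
    generalize (⨅ x, φ x) = L at *
    set δ := L ^ 3 / (1 + s * φ 0 ^ 2) with hδ
    have hδ0 : 0 < δ := by positivity
    have hGd : AntitoneOn (fun x => ψ x + (p + q) * φ x + δ * x) (Ici 0) := by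
      have hd (x : ℝ) := (dG x).add ((hasDerivAt_id x).const_mul δ)
      refine antitoneOn_of_deriv_nonpos (convex_Ici 0)
        (fun x _ => (hd x).continuousAt.continuousWithinAt)
        (fun x _ => (hd x).differentiableAt.differentiableWithinAt) (fun x hx => ?_)
      have h0 : 0 ≤ x := by rw [interior_Ici] at hx; exact le_of_lt hx
      have h1 : φ x ≤ φ 0 := hanti.antitone h0
      have h2 := hLle x
      have h3 := hpos x
      have : δ ≤ φ x ^ 3 / (1 + s * φ x ^ 2) := by
        rw [hδ]; gcongr
      have e := (hd x).deriv
      calc _ = _ := e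
        _ ≤ 0 := by simp only [mul_one]; linarith
    set G0 := ψ 0 + (p + q) * φ 0 with hG0
    have h0 : 0 ≤ G0 := hG 0
    have hx : 0 ≤ (G0 + 1) / δ := by positivity
    have h1 := hGd (mem_Ici.2 le_rfl) (mem_Ici.2 hx) hx
    have h2 := hG ((G0 + 1) / δ)
    have h3 : δ * ((G0 + 1) / δ) = G0 + 1 := by field_simp
    simp only [mul_zero, add_zero] at h1
    linarith
  rw [hI] at tI
  refine ⟨φ, ⟨fun x => (dφ x).differentiableAt, ?_, hpos, ?_, hanti, tφ, tI⟩, ?_⟩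
  · rw [hder]; exact fun x => (dψ x).differentiableAt
  · intro x; rw [hder, hder2]; ring
  · rw [hder]; exact tq

end Aux

/-- For `c > 2/√s` there exist two positive unbounded traveling waves of
speed `c` of two distinct types, distinguished by the asymptotic logarithmic slopes
`φ'/φ → M₋` and `φ'/φ → M₊` as `ξ → -∞`, where
`M± = (-cs ± √(c²s² - 4s))/(2s)`. -/
theorem exists_two_positive_unbounded_traveling_waves_above_critical_speed
    (s c : ℝ) (hs : 0 < s) (hc : 2 / Real.sqrt s < c) :
    ∃ φ₁ φ₂ : ℝ → ℝ,
      ((∀ ξ : ℝ, DifferentiableAt ℝ φ₁ ξ) ∧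
       (∀ ξ : ℝ, DifferentiableAt ℝ (deriv φ₁) ξ) ∧
       (∀ ξ : ℝ, 0 < φ₁ ξ) ∧
       (∀ ξ : ℝ, deriv (deriv φ₁) ξ + c * deriv φ₁ ξ + (φ₁ ξ) ^ 3 / (1 + s * (φ₁ ξ) ^ 2) = 0) ∧
       StrictAnti φ₁ ∧
       Tendsto φ₁ atBot atTop ∧
       Tendsto φ₁ atTop (nhds 0)) ∧
      ((∀ ξ : ℝ, DifferentiableAt ℝ φ₂ ξ) ∧
       (∀ ξ : ℝ, DifferentiableAt ℝ (deriv φ₂) ξ) ∧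
       (∀ ξ : ℝ, 0 < φ₂ ξ) ∧
       (∀ ξ : ℝ, deriv (deriv φ₂) ξ + c * deriv φ₂ ξ + (φ₂ ξ) ^ 3 / (1 + s * (φ₂ ξ) ^ 2) = 0) ∧
       StrictAnti φ₂ ∧
       Tendsto φ₂ atBot atTop ∧
       Tendsto φ₂ atTop (nhds 0)) ∧
      Tendsto (fun ξ => deriv φ₁ ξ / φ₁ ξ) atBot
        (nhds ((-c * s - Real.sqrt (c ^ 2 * s ^ 2 - 4 * s)) / (2 * s))) ∧
      Tendsto (fun ξ => deriv φ₂ ξ / φ₂ ξ) atBot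
        (nhds ((-c * s + Real.sqrt (c ^ 2 * s ^ 2 - 4 * s)) / (2 * s))) := by
  have hs' := Real.sqrt_pos.2 hs
  have hc0 : 0 < c := lt_trans (by positivity) hc
  have hsq : Real.sqrt s ^ 2 = s := Real.sq_sqrt hs.le
  have hD : 0 < c ^ 2 * s ^ 2 - 4 * s := by
    have h1 : 2 < c * Real.sqrt s := (div_lt_iff₀ hs').1 hc
    have h2 : 4 < c ^ 2 * s := by
      have : c ^ 2 * s = (c * Real.sqrt s) ^ 2 := by rw [mul_pow, hsq]
      rw [this]; nlinarith
    nlinarith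
  set d := Real.sqrt (c ^ 2 * s ^ 2 - 4 * s) with hd
  have hd0 : 0 < d := Real.sqrt_pos.2 hD
  have hd2 : d ^ 2 = c ^ 2 * s ^ 2 - 4 * s := Real.sq_sqrt hD.le
  have hcs : 0 < c * s := mul_pos hc0 hs
  have hlt : d < c * s := by nlinarith
  have hp : 0 < (c * s - d) / (2 * s) := div_pos (by linarith) (by linarith)
  have hq : 0 < (c * s + d) / (2 * s) := div_pos (by linarith) (by linarith)
  have hpq : s * ((c * s - d) / (2 * s)) * ((c * s + d) / (2 * s)) = 1 := by
    field_simp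
    nlinarith
  have hsum : (c * s - d) / (2 * s) + (c * s + d) / (2 * s) = c := by field_simp; ring
  obtain ⟨φ₁, h1, t1⟩ := exists_wave hs hp hq hpq (Or.inr rfl)
  obtain ⟨φ₂, h2, t2⟩ := exists_wave hs hp hq hpq (Or.inl rfl)
  rw [hsum] at h1 h2
  refine ⟨φ₁, φ₂, h1, h2, ?_, ?_⟩
  · convert t1 using 2; ring
  · convert t2 using 2; ring
end

section
/- Let s > 0. The set of speeds c > 0 for which the equation u_t = u_xx + u³/(1+s u²) admits a positive unbounded traveling wave of speed c — i.e., a twice differentiable, monotonically decreasing φ : ℝ → ℝ with φ > 0 everywhere, solving φ'' + cφ' + φ³/(1+sφ²) = 0 on ℝ, with φ(ξ) → +∞ as ξ → -∞ and φ(ξ) → 0 as ξ → +∞ — is exactly the set {c : c ≥ 2/√s}. In particular the minimal speed of positive unbounded traveling waves is c* = 2/√s. -/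
open Filter

/-- Globally Lipschitz `C¹` vector fields vanishing at the origin have global integral curves. -/
lemma global_curve {E : Type*} [NormedAddCommGroup E] [NormedSpace ℝ E] [CompleteSpace E]
    (v : E → E) (K : NNReal) (hK : 0 < K) (hL : LipschitzWith K v) (h0 : v 0 = 0)
    (hv : ContDiff ℝ 1 v) (x : E) :
    ∃ γ : ℝ → E, γ 0 = x ∧ ∀ t, HasDerivAt γ (v (γ t)) t := by
  have hKr : (0:ℝ) < K := by exact_mod_cast hK
  have key := exists_isMIntegralCurve_of_isMIntegralCurveOn (I := modelWithCornersSelf ℝ E) (M := E)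
    (v := v) (contMDiff_vectorSpace_iff_contDiff.2 hv) (ε := 1 / (2 * K)) (by positivity) ?_ x
  · obtain ⟨γ, h1, h2⟩ := key
    refine ⟨γ, h1, fun t => ?_⟩
    have h3 : HasFDerivAt γ ((1 : ℝ →L[ℝ] ℝ).smulRight (v (γ t))) t := (h2 t).hasFDerivAt
    simpa using h3.hasDerivAt
  · intro y
    have hε : (0:ℝ) < 1 / (2 * K) := by positivity
    have hPL : IsPicardLindelof (fun _ => v) (tmin := -(1 / (2 * K) : ℝ)) (tmax := 1 / (2 * K))
        ⟨0, by constructor <;> linarith⟩ y (‖y‖₊ + 1) 0 (K * (2 * (‖y‖₊ + 1))) K := by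
      refine ⟨fun t _ => hL.lipschitzOnWith, fun x _ => continuousOn_const, ?_, ?_⟩
      · intro t _ z hz
        have h1 := hL.dist_le_mul z 0
        rw [h0, dist_zero_right, dist_zero_right] at h1
        have h2 : ‖z‖ ≤ ‖y‖ + (‖y‖ + 1) := by
          rw [Metric.mem_closedBall, dist_eq_norm] at hz
          have := norm_le_norm_add_norm_sub y z
          rw [norm_sub_rev] at this
          have e : ((‖y‖₊ + 1 : NNReal) : ℝ) = ‖y‖ + 1 := rfl
          rw [e] at hz
          linarith
        have e : ((K * (2 * (‖y‖₊ + 1)) : NNReal) : ℝ) = K * (2 * (‖y‖ + 1)) := rfl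
        rw [e]
        refine h1.trans ?_
        gcongr
        linarith
      · simp
        apply le_of_eq
        field_simp
    obtain ⟨α, h1, h2⟩ := hPL.exists_eq_forall_mem_Icc_hasDerivWithinAt₀
    refine ⟨α, h1, fun t ht => ?_⟩
    have := ((h2 t (Set.Ioo_subset_Icc_self ht)).mono Set.Ioo_subset_Icc_self).hasFDerivWithinAt.hasMFDerivWithinAt
    exact this

lemma wave_field_curve (s c : ℝ) (hs : 0 < s) (hc : 0 < c) :
    ∃ φ ψ : ℝ → ℝ, φ 0 = 1 ∧ ψ 0 = -(c / 2) ∧ (∀ t, HasDerivAt φ (ψ t) t) ∧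
      ∀ t, HasDerivAt ψ (-c * ψ t - φ t ^ 3 / (1 + s * φ t ^ 2)) t := by
  have hpos : ∀ u : ℝ, 0 < 1 + s * u ^ 2 := fun u => by positivity
  have hf : ∀ u v : ℝ, |u ^ 3 / (1 + s * u ^ 2) - v ^ 3 / (1 + s * v ^ 2)| ≤ 2 / s * |u - v| := by
    intro u v
    have : u ^ 3 / (1 + s * u ^ 2) - v ^ 3 / (1 + s * v ^ 2)
        = (u ^ 2 + u * v + v ^ 2 + s * u ^ 2 * v ^ 2) / ((1 + s * u ^ 2) * (1 + s * v ^ 2))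
          * (u - v) := by
      have := (hpos u).ne'
      have := (hpos v).ne'
      field_simp
      ring
    rw [this, abs_mul]
    gcongr
    rw [abs_of_nonneg (by
      have : 0 ≤ u ^ 2 + u * v + v ^ 2 := by nlinarith [sq_nonneg (u + v), sq_nonneg u, sq_nonneg v]
      positivity)]
    rw [div_le_div_iff₀ (mul_pos (hpos u) (hpos v)) hs]
    have : 0 ≤ s * (2 * u ^ 2 + 2 * v ^ 2 - (u ^ 2 + u * v + v ^ 2)) :=
      mul_nonneg hs.le (by nlinarith [sq_nonneg (u - v), sq_nonneg u, sq_nonneg v])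
    nlinarith [sq_nonneg (s * u * v)]
  obtain ⟨γ, h1, h2⟩ := global_curve (E := ℝ × ℝ)
    (fun p => (p.2, -c * p.2 - p.1 ^ 3 / (1 + s * p.1 ^ 2)))
    (1 + c + 2 / s).toNNReal (Real.toNNReal_pos.2 (by positivity))
    (by
      refine LipschitzWith.of_dist_le_mul fun p q => ?_
      have e1 : |p.1 - q.1| ≤ dist p q := by
        rw [Prod.dist_eq, Real.dist_eq, Real.dist_eq]; exact le_max_left _ _
      have e2 : |p.2 - q.2| ≤ dist p q := by
        rw [Prod.dist_eq, Real.dist_eq, Real.dist_eq]; exact le_max_right _ _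
      have hd : 0 ≤ dist p q := dist_nonneg
      rw [Real.coe_toNNReal _ (by positivity)]
      rw [Prod.dist_eq (x := (_, _))]
      simp only [Real.dist_eq]
      apply max_le
      · have : 0 ≤ (c + 2 / s) * dist p q := by positivity
        linarith
      · have e3 := hf p.1 q.1
        have : -c * p.2 - p.1 ^ 3 / (1 + s * p.1 ^ 2) - (-c * q.2 - q.1 ^ 3 / (1 + s * q.1 ^ 2))
          = -c * (p.2 - q.2) - (p.1 ^ 3 / (1 + s * p.1 ^ 2) - q.1 ^ 3 / (1 + s * q.1 ^ 2)) := by ring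
        rw [this]
        refine (abs_sub _ _).trans ?_
        rw [abs_mul, abs_neg, abs_of_pos hc]
        have e4 : c * |p.2 - q.2| ≤ c * dist p q := by gcongr
        have e5 : 2 / s * |p.1 - q.1| ≤ 2 / s * dist p q := by gcongr
        linarith)
    (by simp)
    (by
      refine contDiff_snd.prodMk (ContDiff.sub (by fun_prop) (ContDiff.div (by fun_prop) (by fun_prop)
        (fun p => (hpos p.1).ne'))))
    (1, -(c / 2))
  refine ⟨fun t => (γ t).1, fun t => (γ t).2, by simp [h1], by simp [h1], fun t => ?_, fun t => ?_⟩
  · exact (hasFDerivAt_fst.comp_hasDerivAt t (h2 t))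
  · exact (hasFDerivAt_snd.comp_hasDerivAt t (h2 t))

lemma mvt_aux {F F' : ℝ → ℝ} (h : ∀ t, HasDerivAt F (F' t) t) {a b : ℝ} (hab : a < b) :
    ∃ x, a < x ∧ x < b ∧ F b - F a = F' x * (b - a) := by
  obtain ⟨x, hx, e⟩ := exists_hasDerivAt_eq_slope F F' hab
    (fun t _ => (h t).continuousAt.continuousWithinAt) (fun t _ => h t)
  have : b - a ≠ 0 := (sub_pos.2 hab).ne'
  exact ⟨x, hx.1, hx.2, by rw [e]; field_simp⟩

lemma wave_necessity (s c : ℝ) (hs : 0 < s) (φ : ℝ → ℝ)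
    (h1 : ∀ ξ : ℝ, DifferentiableAt ℝ φ ξ) (h2 : ∀ ξ : ℝ, DifferentiableAt ℝ (deriv φ) ξ)
    (hp : ∀ ξ : ℝ, 0 < φ ξ)
    (hode : ∀ ξ : ℝ, deriv (deriv φ) ξ + c * deriv φ ξ + (φ ξ) ^ 3 / (1 + s * (φ ξ) ^ 2) = 0)
    (ha : Antitone φ) (hbot : Tendsto φ atBot atTop) : 1 / s ≤ c ^ 2 / 4 := by
  by_contra! hlt
  obtain ⟨δ, hδ, hδe⟩ : ∃ δ : ℝ, 0 < δ ∧ 1 / s = c ^ 2 / 4 + 2 * δ :=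
    ⟨(1 / s - c ^ 2 / 4) / 2, by linarith, by ring⟩
  obtain ⟨b, hb⟩ := eventually_atBot.1 (hbot.eventually_ge_atTop (max 1 (1 / (s ^ 2 * δ))))
  have hw : ∀ t, HasDerivAt (fun t => -deriv φ t / φ t)
      ((-deriv φ t / φ t) ^ 2 - c * (-deriv φ t / φ t) + φ t ^ 2 / (1 + s * φ t ^ 2)) t := by
    intro t
    have := (h2 t).hasDerivAt.neg.div (h1 t).hasDerivAt (hp t).ne'
    refine this.congr_deriv ?_
    have e : deriv (deriv φ) t = - c * deriv φ t - (φ t) ^ 3 / (1 + s * (φ t) ^ 2) := by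
      linarith [hode t]
    rw [e]
    have h3 := (hp t).ne'
    have h4 : 1 + s * φ t ^ 2 ≠ 0 := by have := hp t; positivity
    simp only [Pi.neg_apply]
    field_simp
    ring
  have hw0 : ∀ t, 0 ≤ -deriv φ t / φ t := fun t =>
    div_nonneg (neg_nonneg.2 ha.deriv_nonpos) (hp t).le
  set w := fun t => -deriv φ t / φ t with hwdef
  have hab : b - (w b + 1) / δ < b := by
    have : 0 < (w b + 1) / δ := div_pos (by linarith [hw0 b]) hδ
    linarith
  obtain ⟨x, -, hxb, e⟩ := mvt_aux hw hab
  have hg : c ^ 2 / 4 + δ ≤ φ x ^ 2 / (1 + s * φ x ^ 2) := by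
    have h3 := hb x hxb.le
    have h4 : 1 ≤ φ x := (le_max_left _ _).trans h3
    have h5 : 1 / (s ^ 2 * δ) ≤ φ x ^ 2 := ((le_max_right _ _).trans h3).trans (by nlinarith)
    rw [div_le_iff₀ (by positivity)] at h5
    have h6 : c ^ 2 / 4 + δ = 1 / s - δ := by linarith
    rw [h6, le_div_iff₀ (by positivity)]
    have h7 : (1 / s - δ) * (1 + s * φ x ^ 2) = φ x ^ 2 + (1 - φ x ^ 2 * (s ^ 2 * δ)) / s - δ := by
      field_simp
      ring
    have h8 : (1 - φ x ^ 2 * (s ^ 2 * δ)) / s ≤ 0 := div_nonpos_of_nonpos_of_nonneg (by linarith) hs.le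
    linarith
  have hs' : δ ≤ (-deriv φ x / φ x) ^ 2 - c * (-deriv φ x / φ x) + φ x ^ 2 / (1 + s * φ x ^ 2) := by
    nlinarith [sq_nonneg (-deriv φ x / φ x - c / 2)]
  have h9 : δ * (b - (b - (w b + 1) / δ)) = w b + 1 := by field_simp; ring
  have h10 := mul_le_mul_of_nonneg_right hs' (sub_pos.2 hab).le
  have h11 := hw0 (b - (w b + 1) / δ)
  have h12 : w b - w (b - (w b + 1) / δ) ≥ w b + 1 := by
    rw [h9] at h10
    exact h10.trans (le_of_eq e.symm)
  have h13 : w (b - (w b + 1) / δ) ≥ 0 := h11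
  linarith

lemma wave_sufficiency (s c : ℝ) (hs : 0 < s) (hc : 0 < c) (hcs : 1 / s ≤ c ^ 2 / 4) :
    ∃ φ : ℝ → ℝ,
          (∀ ξ : ℝ, DifferentiableAt ℝ φ ξ) ∧
          (∀ ξ : ℝ, DifferentiableAt ℝ (deriv φ) ξ) ∧
          (∀ ξ : ℝ, 0 < φ ξ) ∧
          (∀ ξ : ℝ, deriv (deriv φ) ξ + c * deriv φ ξ + (φ ξ) ^ 3 / (1 + s * (φ ξ) ^ 2) = 0) ∧
          Antitone φ ∧
          Tendsto φ atBot atTop ∧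
          Tendsto φ atTop (nhds 0) := by
  obtain ⟨φ, ψ, hφ0, hψ0, hφ, hψ⟩ := wave_field_curve s c hs hc
  have hpos : ∀ u : ℝ, 0 < 1 + s * u ^ 2 := fun u => by positivity
  have hd : deriv φ = ψ := funext fun t => (hφ t).deriv
  have hE : ∀ t, HasDerivAt (fun t => Real.exp (c / 2 * t)) (c / 2 * Real.exp (c / 2 * t)) t := by
    intro t
    have := ((hasDerivAt_id t).const_mul (c / 2)).exp
    refine this.congr_deriv ?_
    simp [mul_comm]
  set E := fun t => Real.exp (c / 2 * t) with hEdef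
  replace hE : ∀ t, HasDerivAt E (c / 2 * E t) t := hE
  have hEpos : ∀ t, 0 < E t := fun t => Real.exp_pos _
  have hE0 : E 0 = 1 := by simp [hEdef]
  -- the rescaled profile and its derivative
  have hΦ : ∀ t, HasDerivAt (fun t => E t * φ t) (E t * (ψ t + c / 2 * φ t)) t := fun t =>
    ((hE t).mul (hφ t)).congr_deriv (by ring)
  have hP : ∀ t, HasDerivAt (fun t => E t * (ψ t + c / 2 * φ t))
      ((c ^ 2 / 4 - φ t ^ 2 / (1 + s * φ t ^ 2)) * (E t * φ t)) t := fun t =>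
    ((hE t).mul ((hψ t).add ((hφ t).const_mul (c / 2)))).congr_deriv
      (by simp only [Pi.add_apply]; ring)
  have hk : ∀ u : ℝ, 0 ≤ c ^ 2 / 4 - u ^ 2 / (1 + s * u ^ 2) := by
    intro u
    have : u ^ 2 / (1 + s * u ^ 2) ≤ 1 / s := by
      rw [div_le_div_iff₀ (hpos u) hs]; linarith
    linarith
  set Φ := fun t => E t * φ t with hΦdef
  set P := fun t => E t * (ψ t + c / 2 * φ t) with hPdef
  have hΦ0 : Φ 0 = 1 := by simp [hΦdef, hE0, hφ0]
  have hP0 : P 0 = 0 := by simp [hPdef, hE0, hφ0, hψ0]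
  have hΦP : ∀ t, HasDerivAt (fun t => Φ t * P t)
      (P t ^ 2 + (c ^ 2 / 4 - φ t ^ 2 / (1 + s * φ t ^ 2)) * Φ t ^ 2) t := fun t =>
    ((hΦ t).mul (hP t)).congr_deriv (by simp only [hΦdef, hPdef]; ring)
  have hΦPnn : ∀ t, 0 ≤ P t ^ 2 + (c ^ 2 / 4 - φ t ^ 2 / (1 + s * φ t ^ 2)) * Φ t ^ 2 := fun t =>
    add_nonneg (sq_nonneg _) (mul_nonneg (hk _) (sq_nonneg _))
  have hright : ∀ t, 0 ≤ t → 0 ≤ Φ t * P t := by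
    intro t ht
    rcases ht.eq_or_lt with rfl | ht
    · simp [hP0]
    · obtain ⟨x, -, -, e⟩ := mvt_aux hΦP ht
      have := mul_nonneg (hΦPnn x) (sub_pos.2 ht).le
      simp only [hP0, mul_zero, sub_zero] at e this
      linarith
  have hleft : ∀ t, t ≤ 0 → Φ t * P t ≤ 0 := by
    intro t ht
    rcases ht.eq_or_lt with rfl | ht
    · simp [hP0]
    · obtain ⟨x, -, -, e⟩ := mvt_aux hΦP ht
      have := mul_nonneg (hΦPnn x) (sub_pos.2 ht).le
      simp only [hP0, mul_zero, zero_sub] at e this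
      linarith
  have hΦsq' : ∀ t, HasDerivAt (fun t => Φ t ^ 2) (2 * (Φ t * P t)) t := fun t =>
    ((hΦ t).pow 2).congr_deriv (by simp; ring)
  have hΦsq : ∀ t, 1 ≤ Φ t ^ 2 := by
    intro t
    rcases lt_trichotomy t 0 with ht | rfl | ht
    · obtain ⟨x, -, hx, e⟩ := mvt_aux hΦsq' ht
      have := hleft x hx.le
      simp only [hΦ0] at e
      nlinarith
    · simp [hΦ0]
    · obtain ⟨x, hx, -, e⟩ := mvt_aux hΦsq' ht
      have := hright x hx.le
      simp only [hΦ0] at e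
      nlinarith
  have hΦcont : Continuous Φ := continuous_iff_continuousAt.2 fun t => (hΦ t).continuousAt
  have hΦpos : ∀ t, 0 < Φ t := by
    intro t
    by_contra! hn
    obtain ⟨x, hx⟩ := mem_range_of_exists_le_of_exists_ge hΦcont ⟨t, hn⟩ ⟨0, by rw [hΦ0]; exact zero_le_one⟩
    have := hΦsq x
    rw [hx] at this
    norm_num at this
  have hΦ1 : ∀ t, 1 ≤ Φ t := fun t => by nlinarith [hΦsq t, hΦpos t]
  have hφpos : ∀ t, 0 < φ t := fun t => pos_of_mul_pos_right (hΦpos t) (hEpos t).le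
  have hfpos : ∀ t, 0 < φ t ^ 3 / (1 + s * φ t ^ 2) := fun t =>
    div_pos (pow_pos (hφpos t) 3) (hpos _)
  have hψr : ∀ t, 0 ≤ t → 0 ≤ ψ t + c / 2 * φ t := fun t ht =>
    nonneg_of_mul_nonneg_right (nonneg_of_mul_nonneg_right (hright t ht) (hΦpos t)) (hEpos t)
  have hψl : ∀ t, t ≤ 0 → ψ t + c / 2 * φ t ≤ 0 := by
    intro t ht
    by_contra! h
    have := mul_pos (hΦpos t) (mul_pos (hEpos t) h)
    have h' : Φ t * (E t * (ψ t + c / 2 * φ t)) ≤ 0 := hleft t ht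
    linarith
  have hψnp : ∀ t, ψ t ≤ 0 := by
    intro t
    rcases le_or_gt t 0 with ht | ht
    · have := hψl t ht
      have := mul_pos hc (hφpos t)
      linarith
    · have hQ : ∀ t, HasDerivAt (fun t => E t ^ 2 * ψ t)
          (-(E t ^ 2 * (φ t ^ 3 / (1 + s * φ t ^ 2)))) t := fun t =>
        (((hE t).pow 2).mul (hψ t)).congr_deriv (by simp; ring)
      obtain ⟨x, -, -, e⟩ := mvt_aux hQ ht
      have h1 := mul_pos (mul_pos (pow_pos (hEpos x) 2) (hfpos x)) ht
      simp only [hE0, hψ0, sub_zero] at e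
      by_contra! h
      have h2 := mul_pos (pow_pos (hEpos t) 2) h
      nlinarith
  have hanti : Antitone φ := antitone_of_deriv_nonpos (fun t => (hφ t).differentiableAt)
    (fun t => by rw [hd]; exact hψnp t)
  refine ⟨φ, fun t => (hφ t).differentiableAt, fun t => by rw [hd]; exact (hψ t).differentiableAt,
    hφpos, fun t => by rw [hd, (hψ t).deriv]; ring, hanti, ?_, ?_⟩
  · have h1 : Tendsto (fun t : ℝ => Real.exp (-(c / 2) * t)) atBot atTop :=
      Real.tendsto_exp_atTop.comp
        ((tendsto_const_mul_atTop_of_neg (by linarith)).2 tendsto_id)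
    refine tendsto_atTop_mono (fun t => ?_) h1
    have h2 : 1 ≤ E t * φ t := hΦ1 t
    have h3 : Real.exp (-(c / 2) * t) * E t = 1 := by
      rw [hEdef]; simp only; rw [← Real.exp_add]; simp
    have := mul_le_mul_of_nonneg_left h2 (Real.exp_pos (-(c / 2) * t)).le
    rw [← mul_assoc, h3] at this
    linarith
  · have hbdd : BddBelow (Set.range φ) := ⟨0, by rintro _ ⟨t, rfl⟩; exact (hφpos t).le⟩
    have hlim := tendsto_atTop_ciInf hanti hbdd
    have hL0 : 0 ≤ ⨅ t, φ t := le_ciInf fun t => (hφpos t).le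
    have hLle : ∀ t, (⨅ t, φ t) ≤ φ t := fun t => ciInf_le hbdd t
    set L := ⨅ t, φ t
    rcases hL0.eq_or_lt with h | hL
    · rw [← h] at hlim; exact hlim
    exfalso
    have hR : ∀ t, HasDerivAt (fun t => ψ t + c * φ t) (-(φ t ^ 3 / (1 + s * φ t ^ 2))) t := fun t =>
      ((hψ t).add ((hφ t).const_mul c)).congr_deriv (by ring)
    have hm : 0 < L ^ 3 / (1 + s) := by positivity
    set m := L ^ 3 / (1 + s)
    have hT : 0 < c / m := div_pos hc hm
    obtain ⟨x, hx, -, e⟩ := mvt_aux hR hT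
    have h1 : m ≤ φ x ^ 3 / (1 + s * φ x ^ 2) := by
      have h2 : φ x ≤ 1 := by rw [← hφ0]; exact hanti hx.le
      have h3 := hφpos x
      have h4 := hLle x
      apply div_le_div₀ (by positivity) (by gcongr) (hpos _)
      have : φ x ^ 2 ≤ 1 := by nlinarith
      nlinarith
    have h5 := hψr (c / m) hT.le
    have h6 := mul_pos hc (hφpos (c / m))
    have h7 : m * (c / m) = c := by field_simp
    have h8 := mul_le_mul_of_nonneg_right h1 hT.le
    simp only [hφ0, hψ0, sub_zero] at e
    nlinarith

/-- For `s > 0`, a positive unbounded traveling wave of speed `c > 0` for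
`u_t = u_xx + u³/(1+s u²)` exists if and only if `c ≥ 2/√s`; i.e. the minimal speed is
`c* = 2/√s`. -/
theorem positive_unbounded_traveling_wave_iff_ge_minimal_speed
    (s : ℝ) (hs : 0 < s) :
    ∀ c : ℝ, 0 < c →
      ((∃ φ : ℝ → ℝ,
          (∀ ξ : ℝ, DifferentiableAt ℝ φ ξ) ∧
          (∀ ξ : ℝ, DifferentiableAt ℝ (deriv φ) ξ) ∧
          (∀ ξ : ℝ, 0 < φ ξ) ∧
          (∀ ξ : ℝ, deriv (deriv φ) ξ + c * deriv φ ξ + (φ ξ) ^ 3 / (1 + s * (φ ξ) ^ 2) = 0) ∧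
          Antitone φ ∧
          Tendsto φ atBot atTop ∧
          Tendsto φ atTop (nhds 0)) ↔
        2 / Real.sqrt s ≤ c) := by
  intro c hc
  have hsq : 0 < Real.sqrt s := Real.sqrt_pos.2 hs
  have hss : Real.sqrt s ^ 2 = s := Real.sq_sqrt hs.le
  have hiff : 2 / Real.sqrt s ≤ c ↔ 1 / s ≤ c ^ 2 / 4 := by
    rw [div_le_iff₀ hsq, div_le_div_iff₀ hs (by norm_num)]
    have h0 : 0 < c * Real.sqrt s := mul_pos hc hsq
    have h1 : c ^ 2 * s = (c * Real.sqrt s) ^ 2 := by rw [mul_pow, hss]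
    rw [h1]
    constructor <;> intro h <;> nlinarith
  rw [hiff]
  constructor
  · rintro ⟨φ, h1, h2, hp, hode, ha, hbot, -⟩
    exact wave_necessity s c hs φ h1 h2 hp hode ha hbot
  · exact wave_sufficiency s c hs hc
end

section
/- Let s > 0 and 0 < c < 2/√s. Then every twice differentiable function φ : ℝ → ℝ satisfying φ''(ξ) + c·φ'(ξ) + φ(ξ)³/(1 + s·φ(ξ)²) = 0 for all ξ ∈ ℝ, with φ(ξ) → 0 as ξ → +∞ and φ not identically zero, changes sign infinitely often: the zero set {ξ ∈ ℝ : φ(ξ) = 0} is infinite. -/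
open Filter

/-- A function whose derivative is at most `-m` on `(-∞, a]` grows linearly backwards. -/
lemma backward_growth (f f' : ℝ → ℝ) (a m : ℝ) (hf : ∀ x, x ≤ a → HasDerivAt f (f' x) x)
    (hm : ∀ x, x ≤ a → f' x ≤ -m) (x : ℝ) (hx : x ≤ a) : f a + m * (a - x) ≤ f x := by
  have h := (convex_Iic a).image_sub_le_mul_sub_of_deriv_le (f := f) (C := -m)
    (fun y hy => (hf y hy).continuousAt.continuousWithinAt)
    (fun y hy => (hf y (Set.mem_Iic.1 (interior_subset hy))).differentiableAt.differentiableWithinAt)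
    (fun y hy => by
      have hy' : y ≤ a := Set.mem_Iic.1 (interior_subset hy)
      rw [(hf y hy').deriv]; exact hm y hy')
    x hx a (Set.mem_Iic.2 le_rfl) hx
  linarith

/-- No solution is positive on a left half line when the speed is subcritical. -/
lemma no_positive_left (s c : ℝ) (hs : 0 < s) (hc : 0 < c) (hsc : s * c ^ 2 < 4)
    (u p : ℝ → ℝ) (hu : ∀ x, HasDerivAt u (p x) x)
    (hp : ∀ x, HasDerivAt p (-(c * p x) - (u x) ^ 3 / (1 + s * (u x) ^ 2)) x)
    (a : ℝ) (hpos : ∀ x, x ≤ a → 0 < u x) : False := by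
  have hden : ∀ x, 0 < 1 + s * (u x) ^ 2 := fun x => by positivity
  -- the derivative is nonpositive
  have hp0 : ∀ b, b ≤ a → p b ≤ 0 := by
    intro b hb
    by_contra! hpb
    have hF : ∀ x, x ≤ b → p b ≤ p x := by
      intro x hx
      have h := backward_growth (fun x => Real.exp (c * x) * p x)
        (fun x => -(Real.exp (c * x) * ((u x) ^ 3 / (1 + s * (u x) ^ 2)))) b 0
        (fun y _ => by
          have h1 : HasDerivAt (fun x => Real.exp (c * x)) (Real.exp (c * y) * (c * 1)) y :=
            ((hasDerivAt_id y).const_mul c).exp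
          refine (h1.mul (hp y)).congr_deriv ?_
          ring)
        (fun y hy => by
          have := hpos y (hy.trans hb)
          have := hden y
          have : 0 < Real.exp (c * y) * ((u y) ^ 3 / (1 + s * (u y) ^ 2)) := by positivity
          linarith) x hx
      have h2 : Real.exp (c * x) * p b ≤ Real.exp (c * b) * p b := by
        gcongr
      have h3 : Real.exp (c * x) * p b ≤ Real.exp (c * x) * p x := by
        linarith
      exact le_of_mul_le_mul_left h3 (Real.exp_pos _)
    have hub := hpos b hb
    have hx : b - u b / p b ≤ b := by
      have : 0 < u b / p b := by positivity
      linarith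
    have h := backward_growth (fun x => - u x) (fun x => - p x) b (p b)
      (fun y _ => (hu y).neg) (fun y hy => by have := hF y hy; linarith) _ hx
    have h4 := hpos _ (hx.trans hb)
    have h5 : p b * (b - (b - u b / p b)) = u b := by field_simp; ring
    simp only [h5] at h
    linarith
  -- u is large far left
  have hA := hpos a le_rfl
  have hmono : ∀ x, x ≤ a → u a ≤ u x := by
    intro x hx
    have h := backward_growth u p a 0 (fun y _ => hu y)
      (fun y hy => by have := hp0 y hy; linarith) x hx
    linarith
  obtain ⟨m, hm⟩ : ∃ m, m = (u a) ^ 3 / (1 + s * (u a) ^ 2) := ⟨_, rfl⟩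
  have hm0 : 0 < m := by rw [hm]; have := hden a; positivity
  have hlarge : ∀ M : ℝ, ∃ b, b ≤ a ∧ ∀ x, x ≤ b → M ≤ u x := by
    intro M
    refine ⟨a - |c * M - (p a + c * u a)| / m, ?_, ?_⟩
    · have : 0 ≤ |c * M - (p a + c * u a)| / m := by positivity
      linarith
    · intro x hx
      have hxa : x ≤ a := by
        have : 0 ≤ |c * M - (p a + c * u a)| / m := by positivity
        linarith
      have h := backward_growth (fun x => p x + c * u x)
        (fun x => - ((u x) ^ 3 / (1 + s * (u x) ^ 2))) a m
        (fun y _ => by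
          refine ((hp y).add ((hu y).const_mul c)).congr_deriv ?_
          ring)
        (fun y hy => by
          have h1 := hmono y hy
          have h2 : m ≤ (u y) ^ 3 / (1 + s * (u y) ^ 2) := by
            rw [hm, div_le_div_iff₀ (hden a) (hden y)]
            have h3 : (u a) ^ 3 ≤ (u y) ^ 3 := by gcongr
            have h4 : 0 ≤ s * ((u a) ^ 2 * (u y) ^ 2 * (u y - u a)) := by
              have : 0 ≤ u y - u a := by linarith
              positivity
            nlinarith
          linarith) x hxa
      have h6 : |c * M - (p a + c * u a)| ≤ m * (a - x) := by
        have : |c * M - (p a + c * u a)| / m ≤ a - x := by linarith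
        rw [div_le_iff₀ hm0] at this
        linarith
      have h7 := le_abs_self (c * M - (p a + c * u a))
      have h8 := hp0 x hxa
      have : c * M ≤ c * u x := by linarith
      exact le_of_mul_le_mul_left this hc
  -- Riccati argument
  obtain ⟨k, hk⟩ : ∃ k, k = (c ^ 2 / 4 + 1 / s) / 2 := ⟨_, rfl⟩
  have hks : k * s = (s * c ^ 2 / 4 + 1) / 2 := by rw [hk]; field_simp
  have hk1 : 0 < 1 - k * s := by rw [hks]; linarith
  have hkd : 0 < k - c ^ 2 / 4 := by
    have : c ^ 2 / 4 < 1 / s := by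
      rw [lt_div_iff₀ hs]; linarith
    rw [hk]; linarith
  obtain ⟨b, hba, hb⟩ := hlarge (max 1 (k / (1 - k * s)))
  have hq : ∀ x, x ≤ b → k ≤ (u x) ^ 2 / (1 + s * (u x) ^ 2) := by
    intro x hx
    have h1 := (le_max_left _ _).trans (hb x hx)
    have h2 := (le_max_right _ _).trans (hb x hx)
    rw [div_le_iff₀ hk1] at h2
    rw [le_div_iff₀ (hden x)]
    have : u x * (1 - k * s) ≤ u x ^ 2 * (1 - k * s) := by
      gcongr
      nlinarith
    nlinarith
  obtain ⟨d, hd⟩ : ∃ d, d = k - c ^ 2 / 4 := ⟨_, rfl⟩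
  have hd0 : 0 < d := hd ▸ hkd
  have hw := backward_growth (fun x => p x / u x)
    (fun x => ((-(c * p x) - (u x) ^ 3 / (1 + s * (u x) ^ 2)) * u x - p x * p x) / (u x) ^ 2) b d
    (fun y hy => (hp y).div (hu y) (hpos y (hy.trans hba)).ne')
    (fun y hy => by
      have h0 := hpos y (hy.trans hba)
      have h1 := hq y hy
      have h2 : ((-(c * p y) - (u y) ^ 3 / (1 + s * (u y) ^ 2)) * u y - p y * p y) / (u y) ^ 2
          = -(p y / u y + c / 2) ^ 2 + c ^ 2 / 4 - (u y) ^ 2 / (1 + s * (u y) ^ 2) := by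
        have := (hden y).ne'
        field_simp
        ring
      rw [h2, hd]
      nlinarith [sq_nonneg (p y / u y + c / 2)])
  have hx : b - (|p b / u b| + 1) / d ≤ b := by
    have : 0 ≤ (|p b / u b| + 1) / d := by positivity
    linarith
  have h := hw _ hx
  have h5 : d * (b - (b - (|p b / u b| + 1) / d)) = |p b / u b| + 1 := by field_simp; ring
  simp only [h5] at h
  have h6 := neg_abs_le (p b / u b)
  have h7 := div_nonpos_of_nonpos_of_nonneg (hp0 _ (hx.trans hba)) (hpos _ (hx.trans hba)).le
  linarith

/-- For `0 < c < 2/√s`, every nontrivial twice differentiable global solution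
of the traveling-wave ODE tending to `0` at `+∞` changes sign infinitely often: its zero
set is infinite. -/
theorem zero_set_infinite_below_critical_speed
    (s c : ℝ) (hs : 0 < s) (hc : 0 < c) (hcs : c < 2 / Real.sqrt s)
    (φ : ℝ → ℝ)
    (hφ : ∀ ξ : ℝ, DifferentiableAt ℝ φ ξ)
    (hφ' : ∀ ξ : ℝ, DifferentiableAt ℝ (deriv φ) ξ)
    (hode : ∀ ξ : ℝ, deriv (deriv φ) ξ + c * deriv φ ξ + (φ ξ) ^ 3 / (1 + s * (φ ξ) ^ 2) = 0)
    (hlim : Tendsto φ atTop (nhds 0))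
    (hne : φ ≠ 0) :
    {ξ : ℝ | φ ξ = 0}.Infinite := by
  intro hfin
  have hsc : s * c ^ 2 < 4 := by
    have hq : 0 < Real.sqrt s := Real.sqrt_pos.2 hs
    rw [lt_div_iff₀ hq] at hcs
    have h1 : (c * Real.sqrt s) ^ 2 < 2 ^ 2 := by gcongr
    rw [mul_pow, Real.sq_sqrt hs.le] at h1
    linarith
  have hp : ∀ x, HasDerivAt (deriv φ)
      (-(c * deriv φ x) - (φ x) ^ 3 / (1 + s * (φ x) ^ 2)) x := fun x => by
    have h := (hφ' x).hasDerivAt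
    have h2 : deriv (deriv φ) x = -(c * deriv φ x) - (φ x) ^ 3 / (1 + s * (φ x) ^ 2) := by
      linarith [hode x]
    rwa [h2] at h
  obtain ⟨l, hl⟩ := hfin.bddBelow
  have hnz : ∀ x, x ≤ l - 1 → φ x ≠ 0 := fun x hx h0 => by
    have : l ≤ x := hl h0
    linarith
  have hcont : Continuous φ := continuous_iff_continuousAt.2 fun x => (hφ x).continuousAt
  have hivt : ∀ x, x ≤ l - 1 → 0 < φ x * φ (l - 1) := by
    intro x hx
    by_contra! hneg
    have h0 : (0 : ℝ) ∈ Set.uIcc (φ x) (φ (l - 1)) := by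
      rw [Set.mem_uIcc]
      rcases mul_nonpos_iff.1 hneg with h | h
      · exact Or.inr ⟨h.2, h.1⟩
      · exact Or.inl ⟨h.1, h.2⟩
    obtain ⟨y, hy, hy0⟩ := intermediate_value_uIcc hcont.continuousOn h0
    rw [Set.uIcc_of_le hx] at hy
    exact hnz y hy.2 hy0
  rcases lt_or_gt_of_ne (hnz _ le_rfl) with h | h
  · refine no_positive_left s c hs hc hsc (fun x => -φ x) (fun x => -deriv φ x)
      (fun x => (hφ x).hasDerivAt.neg) (fun x => ?_) (l - 1) (fun x hx => ?_)
    · refine (hp x).neg.congr_deriv ?_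
      have e1 : (-φ x) ^ 3 = -(φ x ^ 3) := by ring
      have e2 : (-φ x) ^ 2 = φ x ^ 2 := by ring
      rw [e1, e2]
      ring
    · have := hivt x hx
      have : φ x < 0 := by nlinarith
      linarith
  · refine no_positive_left s c hs hc hsc φ (deriv φ)
      (fun x => (hφ x).hasDerivAt) hp (l - 1) (fun x hx => ?_)
    exact pos_of_mul_pos_left (hivt x hx) h.le
end

section
/- Let s > 0 and 0 < c < 2/√s. Then there exists an unbounded traveling wave of speed c that oscillates infinitely many times: there exist α ∈ ℝ ∪ {-∞} and a function φ, twice differentiable on the interval (α, +∞), satisfying φ''(ξ) + c·φ'(ξ) + φ(ξ)³/(1 + s·φ(ξ)²) = 0 for all ξ > α, such that φ(ξ) → 0 as ξ → +∞, the zero set {ξ > α : φ(ξ) = 0} is infinite, and limsup of φ(ξ)² + φ'(ξ)² as ξ → α from the right is +∞. -/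
open Filter
section
open Set

lemma tw_global_exists (v : ℝ × ℝ → ℝ × ℝ) (hv : ContDiff ℝ 1 v) (M : ℝ) (hM : 0 < M)
    (hb : ∀ x, ‖v x‖ ≤ M * ‖x‖) (x₀ : ℝ × ℝ) :
    ∃ γ : ℝ → ℝ × ℝ, γ 0 = x₀ ∧ ∀ t, HasDerivAt γ (v (γ t)) t := by
  have key := exists_isMIntegralCurve_of_isMIntegralCurveOn (I := modelWithCornersSelf ℝ (ℝ × ℝ))
    (M := ℝ × ℝ) (v := v) (contMDiff_vectorSpace_iff_contDiff.2 hv) (ε := 1 / (2 * M))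
    (by positivity) ?_ x₀
  · obtain ⟨γ, h0, h⟩ := key
    refine ⟨γ, h0, fun t => ?_⟩
    have h1 : HasFDerivAt γ (ContinuousLinearMap.smulRight (1 : ℝ →L[ℝ] ℝ) (v (γ t))) t :=
      (h t).hasFDerivAt
    exact h1.hasDerivAt.congr_deriv (by simp)
  · intro x
    obtain ⟨K, hK⟩ : ∃ K, LipschitzOnWith K v (Metric.closedBall x (‖x‖ + 1)) :=
      (hv.contDiffOn).exists_lipschitzOnWith one_ne_zero (convex_closedBall _ _)
        (isCompact_closedBall _ _)
    have hε : (0:ℝ) < 1 / (2 * M) := by positivity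
    have hp : IsPicardLindelof (fun _ => v) (tmin := -(1 / (2 * M))) (tmax := 1 / (2 * M))
        ⟨0, by constructor <;> linarith⟩ x ⟨‖x‖ + 1, by positivity⟩ 0
        ⟨M * (2 * ‖x‖ + 1), by positivity⟩ K := by
      apply IsPicardLindelof.of_time_independent
      · intro y hy
        have h1 : ‖y - x‖ ≤ ‖x‖ + 1 := by
          have h3 : dist y x ≤ ‖x‖ + 1 := hy
          rwa [dist_eq_norm] at h3
        have h2 : ‖y‖ ≤ 2 * ‖x‖ + 1 := by
          have := norm_add_le (y - x) x
          simp only [sub_add_cancel] at this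
          linarith
        exact (hb y).trans (by show _ ≤ M * (2 * ‖x‖ + 1); gcongr)
      · exact hK
      · show M * (2 * ‖x‖ + 1) * max (1 / (2 * M) - 0) (0 - -(1 / (2 * M))) ≤ (‖x‖ + 1) - 0
        simp only [sub_zero, zero_sub, neg_neg, max_self]
        have : M * (2 * ‖x‖ + 1) * (1 / (2 * M)) = ‖x‖ + 1 / 2 := by field_simp
        linarith
    obtain ⟨γ, h0, h⟩ := hp.exists_eq_forall_mem_Icc_hasDerivWithinAt₀
    refine ⟨γ, h0, fun t ht => ?_⟩
    have h1 := (h t (Ioo_subset_Icc_self ht)).mono Ioo_subset_Icc_self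
    exact h1.hasFDerivWithinAt.hasMFDerivWithinAt

lemma tw_mv (f f' : ℝ → ℝ) (a b δ : ℝ) (hab : a ≤ b)
    (hf : ∀ t ∈ Icc a b, HasDerivAt f (f' t) t) (hd : ∀ t ∈ Icc a b, f' t ≤ -δ) :
    f b ≤ f a - δ * (b - a) := by
  rcases hab.eq_or_lt with rfl | hab
  · simp
  · obtain ⟨x, hx, h⟩ := exists_hasDerivAt_eq_slope f f' hab
      (fun t ht => (hf t ht).continuousAt.continuousWithinAt)
      (fun t ht => hf t (Ioo_subset_Icc_self ht))
    have h2 := hd x (Ioo_subset_Icc_self hx)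
    rw [h, div_le_iff₀ (by linarith)] at h2
    linarith

/-- The Lyapunov function. -/
noncomputable def twV (s c x y : ℝ) : ℝ :=
  x * y + c * x ^ 2 / 2 + y ^ 2 / c + 2 / c * (x ^ 2 / (2 * s) - Real.log (1 + s * x ^ 2) / (2 * s ^ 2))

lemma twV_deriv (s c : ℝ) (hs : 0 < s) (hc : 0 < c) (φ p : ℝ → ℝ)
    (hφ : ∀ t, HasDerivAt φ (p t) t)
    (hp : ∀ t, HasDerivAt p (-c * p t - φ t ^ 3 / (1 + s * φ t ^ 2)) t) (t : ℝ) :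
    HasDerivAt (fun t => twV s c (φ t) (p t))
      (-(φ t ^ 4 / (1 + s * φ t ^ 2) + p t ^ 2)) t := by
  have hpos : 0 < 1 + s * φ t ^ 2 := by positivity
  have h1 := (hφ t).mul (hp t)
  have h2 := (((hφ t).pow 2).const_mul c).div_const 2
  have h3 := ((hp t).pow 2).div_const c
  have h4 := ((hφ t).pow 2).div_const (2 * s)
  have h5 := (((((hφ t).pow 2).const_mul s).const_add 1).log hpos.ne').div_const (2 * s ^ 2)
  have h6 := ((h1.add h2).add h3).add ((h4.sub h5).const_mul (2 / c))
  unfold twV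
  refine h6.congr_deriv ?_
  simp only [Pi.pow_apply]
  push_cast
  field_simp
  ring

lemma twV_lower (s c x y : ℝ) (hs : 0 < s) (hc : 0 < c) : c * x ^ 2 / 4 ≤ twV s c x y := by
  unfold twV
  have h1 : Real.log (1 + s * x ^ 2) ≤ s * x ^ 2 := by
    have := Real.log_le_sub_one_of_pos (show 0 < 1 + s * x ^ 2 by positivity)
    linarith
  have h2 : 0 ≤ x ^ 2 / (2 * s) - Real.log (1 + s * x ^ 2) / (2 * s ^ 2) := by
    have : x ^ 2 / (2 * s) = (s * x ^ 2) / (2 * s ^ 2) := by field_simp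
    rw [this, ← sub_div]
    apply div_nonneg (by linarith) (by positivity)
  have h3 : 0 ≤ 2 / c * (x ^ 2 / (2 * s) - Real.log (1 + s * x ^ 2) / (2 * s ^ 2)) := by positivity
  have h4 : x * y + c * x ^ 2 / 2 + y ^ 2 / c = c * x ^ 2 / 4 + (c * x / 2 + y) ^ 2 / c := by
    field_simp; ring
  have h5 : 0 ≤ (c * x / 2 + y) ^ 2 / c := by positivity
  linarith

lemma twV_upper (s c x y : ℝ) (hs : 0 < s) (hc : 0 < c) :
    twV s c x y ≤ (1 + c + 1 / c + 1 / (c * s)) * (x ^ 2 + y ^ 2) := by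
  unfold twV
  have h1 : 0 ≤ Real.log (1 + s * x ^ 2) / (2 * s ^ 2) := by
    apply div_nonneg (Real.log_nonneg (by nlinarith [sq_nonneg x])) (by positivity)
  have h2 : 2 / c * (x ^ 2 / (2 * s) - Real.log (1 + s * x ^ 2) / (2 * s ^ 2))
      ≤ 2 / c * (x ^ 2 / (2 * s)) := by gcongr; linarith
  have h3 : 2 / c * (x ^ 2 / (2 * s)) = 1 / (c * s) * x ^ 2 := by field_simp
  have h4 : 0 ≤ 1 / (c * s) * y ^ 2 := by positivity
  have h5 : 0 ≤ 1 / c * x ^ 2 := by positivity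
  have h6 : y ^ 2 / c = 1 / c * y ^ 2 := by ring
  nlinarith [sq_nonneg (x - y), sq_nonneg x, sq_nonneg y, mul_nonneg hc.le (sq_nonneg x),
    mul_nonneg hc.le (sq_nonneg y)]

lemma twD_lower (s c v : ℝ) (hs : 0 < s) (hc : 0 < c) (hv : 0 < v) :
    ∃ δ > 0, ∀ x y, v ≤ twV s c x y → δ ≤ x ^ 4 / (1 + s * x ^ 2) + y ^ 2 := by
  obtain ⟨w, hw0, hw⟩ : ∃ w > 0, ∀ x y, v ≤ twV s c x y → 2 * w ≤ x ^ 2 + y ^ 2 := by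
    refine ⟨v / (2 * (1 + c + 1 / c + 1 / (c * s))), by positivity, fun x y h => ?_⟩
    have h1 := h.trans (twV_upper s c x y hs hc)
    have h2 : 0 < 1 + c + 1 / c + 1 / (c * s) := by positivity
    have h3 : 2 * (v / (2 * (1 + c + 1 / c + 1 / (c * s)))) = v / (1 + c + 1 / c + 1 / (c * s)) := by
      generalize 1 + c + 1 / c + 1 / (c * s) = C at *
      field_simp
    rw [h3, div_le_iff₀ h2]
    linarith
  refine ⟨min w (w ^ 2 / (1 + s * w)), by positivity, fun x y h => ?_⟩
  have h0 := hw x y h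
  have hD : 0 ≤ x ^ 4 / (1 + s * x ^ 2) := by positivity
  by_cases hy : w ≤ y ^ 2
  · exact (min_le_left _ _).trans (by linarith)
  · have hx : w ≤ x ^ 2 := by linarith
    have : w ^ 2 / (1 + s * w) ≤ x ^ 4 / (1 + s * x ^ 2) := by
      rw [div_le_div_iff₀ (by positivity) (by positivity)]
      have e : x ^ 4 = (x ^ 2) ^ 2 := by ring
      rw [e]
      generalize x ^ 2 = X at *
      nlinarith [mul_nonneg (mul_nonneg hs.le hw0.le) (mul_nonneg (hw0.le.trans hx) (sub_nonneg.2 hx)),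
        mul_nonneg (add_nonneg hw0.le (hw0.le.trans hx)) (sub_nonneg.2 hx)]
    exact (min_le_right _ _).trans (by linarith [sq_nonneg y])


lemma tw_anti (s c : ℝ) (hs : 0 < s) (hc : 0 < c) (φ p : ℝ → ℝ)
    (hφ : ∀ t, HasDerivAt φ (p t) t)
    (hp : ∀ t, HasDerivAt p (-c * p t - φ t ^ 3 / (1 + s * φ t ^ 2)) t)
    {a b : ℝ} (hab : a ≤ b) : twV s c (φ b) (p b) ≤ twV s c (φ a) (p a) := by
  have := tw_mv (fun t => twV s c (φ t) (p t)) _ a b 0 hab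
    (fun t _ => twV_deriv s c hs hc φ p hφ hp t) (fun t _ => by
      have : 0 ≤ φ t ^ 4 / (1 + s * φ t ^ 2) + p t ^ 2 := by positivity
      linarith)
  simpa using this

lemma tw_growth (s c : ℝ) (hs : 0 < s) (hc : 0 < c) (φ p : ℝ → ℝ)
    (hφ : ∀ t, HasDerivAt φ (p t) t)
    (hp : ∀ t, HasDerivAt p (-c * p t - φ t ^ 3 / (1 + s * φ t ^ 2)) t)
    (h0 : φ 0 = 1) : Tendsto (fun t => φ t ^ 2 + p t ^ 2) atBot atTop := by
  have hV0 : 0 < twV s c (φ 0) (p 0) :=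
    lt_of_lt_of_le (by rw [h0]; positivity) (twV_lower s c (φ 0) (p 0) hs hc)
  obtain ⟨δ, hδ, hD⟩ := twD_lower s c _ hs hc hV0
  have hC : 0 < 1 + c + 1 / c + 1 / (c * s) := by positivity
  set C := 1 + c + 1 / c + 1 / (c * s) with hCdef
  have h1 : ∀ t ≤ 0, δ / C * (-t) ≤ φ t ^ 2 + p t ^ 2 := by
    intro t ht
    have h2 := tw_mv (fun t => twV s c (φ t) (p t)) _ t 0 δ ht
      (fun t _ => twV_deriv s c hs hc φ p hφ hp t) (fun u hu => by
        have := hD _ _ (tw_anti s c hs hc φ p hφ hp hu.2)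
        linarith)
    have h3 := twV_upper s c (φ t) (p t) hs hc
    rw [← hCdef] at h3
    rw [div_mul_eq_mul_div, div_le_iff₀ hC]
    linarith
  refine tendsto_atTop_mono' _ ((eventually_le_atBot 0).mono h1) ?_
  exact (tendsto_neg_atBot_atTop).const_mul_atTop (by positivity)

lemma tw_decay (s c : ℝ) (hs : 0 < s) (hc : 0 < c) (φ p : ℝ → ℝ)
    (hφ : ∀ t, HasDerivAt φ (p t) t)
    (hp : ∀ t, HasDerivAt p (-c * p t - φ t ^ 3 / (1 + s * φ t ^ 2)) t)
    : Tendsto φ atTop (nhds 0) := by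
  have hVnn : ∀ t, 0 ≤ twV s c (φ t) (p t) := fun t =>
    le_trans (by positivity) (twV_lower s c (φ t) (p t) hs hc)
  have hV : ∀ v > 0, ∃ T, ∀ t ≥ T, twV s c (φ t) (p t) < v := by
    intro v hv
    obtain ⟨δ, hδ, hD⟩ := twD_lower s c _ hs hc hv
    by_contra hcon
    push Not at hcon
    have h1 : ∀ t, v ≤ twV s c (φ t) (p t) := fun t => by
      obtain ⟨u, hu, h⟩ := hcon t
      exact h.trans (tw_anti s c hs hc φ p hφ hp hu)
    have hT : 0 ≤ (twV s c (φ 0) (p 0) + 1) / δ := div_nonneg (by linarith [hVnn 0]) hδ.le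
    have h2 := tw_mv (fun t => twV s c (φ t) (p t)) _ 0 _ δ hT
      (fun t _ => twV_deriv s c hs hc φ p hφ hp t) (fun u hu => by
        have := hD _ _ (h1 u)
        linarith)
    have h3 := hVnn ((twV s c (φ 0) (p 0) + 1) / δ)
    have h4 : δ * ((twV s c (φ 0) (p 0) + 1) / δ - 0) = twV s c (φ 0) (p 0) + 1 := by
      field_simp; ring
    rw [h4] at h2
    linarith
  rw [Metric.tendsto_atTop]
  intro ε hε
  obtain ⟨T, hT⟩ := hV (c * ε ^ 2 / 4) (by positivity)
  refine ⟨T, fun t ht => ?_⟩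
  have h1 := (twV_lower s c (φ t) (p t) hs hc).trans_lt (hT t ht)
  rw [Real.dist_eq, sub_zero]
  apply abs_lt_of_sq_lt_sq _ hε.le
  have : c * φ t ^ 2 < c * ε ^ 2 := by linarith
  exact lt_of_mul_lt_mul_left this hc.le

lemma tw_not_pos (s c : ℝ) (hs : 0 < s) (hc : 0 < c) (φ p : ℝ → ℝ)
    (hφ : ∀ t, HasDerivAt φ (p t) t)
    (hp : ∀ t, HasDerivAt p (-c * p t - φ t ^ 3 / (1 + s * φ t ^ 2)) t)
    (hcs : c ^ 2 / 4 < 1 / s) (hN : Tendsto (fun t => φ t ^ 2 + p t ^ 2) atBot atTop)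
    (T : ℝ) (hpos : ∀ t < T, 0 < φ t) : False := by
  -- the derivative is negative
  have hneg : ∀ t < T, p t < 0 := by
    by_contra hcon
    push Not at hcon
    obtain ⟨t1, ht1, hp1⟩ := hcon
    have hq : ∀ t, HasDerivAt (fun t => Real.exp (c * t) * p t)
        (-(Real.exp (c * t) * (φ t ^ 3 / (1 + s * φ t ^ 2)))) t := by
      intro t
      have h1 := (((hasDerivAt_id t).const_mul c).exp).mul (hp t)
      refine h1.congr_deriv ?_
      simp only [id]
      ring
    have hq0 : ∀ t < T, 0 < Real.exp (c * t) * (φ t ^ 3 / (1 + s * φ t ^ 2)) := by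
      intro t ht
      have := hpos t ht
      positivity
    have hqanti : StrictAntiOn (fun t => Real.exp (c * t) * p t) (Iio T) := by
      apply strictAntiOn_of_deriv_neg (convex_Iio T)
        (fun t _ => (hq t).continuousAt.continuousWithinAt)
      intro t ht
      rw [interior_Iio] at ht
      rw [(hq t).deriv]
      linarith [hq0 t ht]
    have hp2 : ∀ t < t1, 0 < p t := by
      intro t ht
      have h1 := hqanti (show t ∈ Iio T from ht.trans ht1) ht1 ht
      have h2 : 0 ≤ Real.exp (c * t1) * p t1 := by positivity
      exact pos_of_mul_pos_right (h2.trans_lt h1) (Real.exp_pos _).le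
    set t2 := t1 - 1 with ht2
    have hp3 : ∀ t ≤ t2, p t2 ≤ p t := by
      intro t ht
      have h1 := hqanti.antitoneOn (show t ∈ Iio T by show t < T; linarith)
        (show t2 ∈ Iio T by show t2 < T; linarith) ht
      have h2 := hp2 t (by linarith)
      have h3 : Real.exp (c * t) ≤ Real.exp (c * t2) := by gcongr
      have h4 : Real.exp (c * t2) * p t2 ≤ Real.exp (c * t2) * p t :=
        h1.trans (by gcongr)
      exact le_of_mul_le_mul_left h4 (Real.exp_pos _)
    have hp2' := hp2 t2 (by linarith)
    have hφ2 := hpos t2 (by linarith)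
    have h5 : (0:ℝ) ≤ φ t2 / p t2 := by positivity
    have h6 := tw_mv (fun t => - φ t) (fun t => - p t) (t2 - φ t2 / p t2) t2 (p t2)
      (by linarith) (fun t _ => (hφ t).neg) (fun t ht => by linarith [hp3 t ht.2])
    have h7 := hpos (t2 - φ t2 / p t2) (by linarith)
    have h8 : p t2 * (t2 - (t2 - φ t2 / p t2)) = φ t2 := by field_simp; ring
    rw [h8] at h6
    linarith
  have hanti : ∀ a b, a ≤ b → b < T → φ b ≤ φ a := by
    intro a b hab hb
    have := tw_mv φ p a b 0 hab (fun t _ => hφ t) (fun t ht => by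
      linarith [hneg t (lt_of_le_of_lt ht.2 hb)])
    linarith
  -- φ large
  have hlarge : ∀ B > 0, ∃ t < T, B < φ t := by
    intro B hB
    by_contra hcon
    push Not at hcon
    obtain ⟨u, hu⟩ := eventually_atBot.1 (hN.eventually_ge_atTop (B ^ 2 + 1))
    set t0 := min u (T - 1) with ht0
    have hlt : t0 < T := lt_of_le_of_lt (min_le_right _ _) (by linarith)
    have hp1 : ∀ t ≤ t0, p t ≤ -1 := by
      intro t ht
      have h1 := hu t (ht.trans (min_le_left _ _))
      have h2 := hcon t (by linarith)
      have h3 := hpos t (by linarith)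
      have h4 := hneg t (by linarith)
      have h5 : φ t ^ 2 ≤ B ^ 2 := by gcongr
      nlinarith
    have h6 := tw_mv φ p (t0 - B) t0 1 (by linarith) (fun t _ => hφ t) (fun t ht => hp1 t ht.2)
    have h7 := hpos t0 hlt
    have h8 := hcon (t0 - B) (by linarith)
    linarith
  -- Riccati
  obtain ⟨m, hm1, hm2⟩ := exists_between hcs
  have hm0 : 0 < m := lt_of_le_of_lt (by positivity) hm1
  have hsm : 0 < 1 - s * m := by
    rw [lt_div_iff₀ hs] at hm2
    linarith
  obtain ⟨t0, ht0, hB⟩ := hlarge (1 + m / (1 - s * m)) (by positivity)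
  have hg : ∀ t ≤ t0, m ≤ φ t ^ 2 / (1 + s * φ t ^ 2) := by
    intro t ht
    have h1 := hB.trans_le (hanti t t0 ht ht0)
    have h2 : 0 < m / (1 - s * m) := by positivity
    have h3 : m / (1 - s * m) ≤ φ t ^ 2 := by nlinarith
    rw [div_le_iff₀ hsm] at h3
    rw [le_div_iff₀ (by positivity)]
    linarith
  have hr : ∀ t ≤ t0, HasDerivAt (fun t => p t / φ t)
      (-c * (p t / φ t) - φ t ^ 2 / (1 + s * φ t ^ 2) - (p t / φ t) ^ 2) t := by
    intro t ht
    have h1 := hpos t (by linarith)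
    refine ((hp t).div (hφ t) h1.ne').congr_deriv ?_
    have : 0 < 1 + s * φ t ^ 2 := by positivity
    field_simp
  have hr0 : ∀ t ≤ t0, p t / φ t < 0 := fun t ht =>
    div_neg_of_neg_of_pos (hneg t (by linarith)) (hpos t (by linarith))
  have hη : 0 < m - c ^ 2 / 4 := by linarith
  have h9 := hr0 t0 le_rfl
  have h10 : 0 ≤ -(p t0 / φ t0) / (m - c ^ 2 / 4) := div_nonneg (by linarith) hη.le
  have h11 := tw_mv (fun t => p t / φ t) _ (t0 - -(p t0 / φ t0) / (m - c ^ 2 / 4)) t0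
    (m - c ^ 2 / 4) (by linarith) (fun t ht => hr t ht.2) (fun t ht => by
      have := hg t ht.2
      nlinarith [sq_nonneg (p t / φ t + c / 2)])
  have h12 := hr0 (t0 - -(p t0 / φ t0) / (m - c ^ 2 / 4)) (by linarith)
  have h13 : (m - c ^ 2 / 4) * (t0 - (t0 - -(p t0 / φ t0) / (m - c ^ 2 / 4))) = -(p t0 / φ t0) := by
    rw [sub_sub_cancel, mul_div_cancel₀ _ hη.ne']
  rw [h13] at h11
  linarith

lemma tw_zeros (s c : ℝ) (hs : 0 < s) (hc : 0 < c) (φ p : ℝ → ℝ)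
    (hφ : ∀ t, HasDerivAt φ (p t) t)
    (hp : ∀ t, HasDerivAt p (-c * p t - φ t ^ 3 / (1 + s * φ t ^ 2)) t)
    (hcs : c ^ 2 / 4 < 1 / s)
    (hN : Tendsto (fun t => φ t ^ 2 + p t ^ 2) atBot atTop) : {t | φ t = 0}.Infinite := by
  intro hfin
  obtain ⟨T, hT⟩ := hfin.bddBelow
  have hne : ∀ t < T, φ t ≠ 0 := fun t ht h => absurd (hT h) (not_le.2 ht)
  have hcont : Continuous φ := continuous_iff_continuousAt.2 fun t => (hφ t).continuousAt
  have hsign : (∀ t < T, 0 < φ t) ∨ (∀ t < T, φ t < 0) := by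
    by_contra hcon
    push Not at hcon
    obtain ⟨⟨a, ha, ha'⟩, b, hb, hb'⟩ := hcon
    obtain ⟨x, hx, hx0⟩ := isPreconnected_Iio.intermediate_value (show a ∈ Iio T from ha)
      (show b ∈ Iio T from hb) hcont.continuousOn ⟨ha', hb'⟩
    exact hne x hx hx0
  rcases hsign with h | h
  · exact tw_not_pos s c hs hc φ p hφ hp hcs hN T h
  · refine tw_not_pos s c hs hc (fun t => -φ t) (fun t => -p t) (fun t => (hφ t).neg)
      (fun t => (hp t).neg.congr_deriv ?_) hcs (by simpa using hN) T
      (fun t ht => by linarith [h t ht])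
    rw [neg_sq, Odd.neg_pow (by decide)]
    ring

lemma tw_filter : Filter.comap (fun x : ℝ => (x : EReal)) (nhdsWithin ⊥ (Set.Ioi ⊥)) = atBot := by
  have h : Set.Ioi (⊥ : EReal) = {⊥}ᶜ := by
    ext x; simp [bot_lt_iff_ne_bot]
  rw [h, EReal.nhdsWithin_bot]
  exact Filter.comap_map EReal.coe_injective

lemma tw_field (s c : ℝ) (hs : 0 < s) (hc : 0 < c) : ∃ φ p : ℝ → ℝ, φ 0 = 1 ∧
    (∀ t, HasDerivAt φ (p t) t) ∧
    (∀ t, HasDerivAt p (-c * p t - φ t ^ 3 / (1 + s * φ t ^ 2)) t) := by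
  obtain ⟨γ, h0, h⟩ := tw_global_exists
    (fun x => (x.2, -c * x.2 - x.1 ^ 3 / (1 + s * x.1 ^ 2)))
    (by
      have : ∀ x : ℝ × ℝ, 1 + s * x.1 ^ 2 ≠ 0 := fun x => by positivity
      fun_prop (disch := assumption)) (1 + c + 1 / s) (by positivity)
    (by
      intro x
      have h1 : |x.1| ≤ ‖x‖ := norm_fst_le x
      have h2 : |x.2| ≤ ‖x‖ := norm_snd_le x
      have hn : 0 ≤ ‖x‖ := norm_nonneg x
      have h3 : |x.1 ^ 3 / (1 + s * x.1 ^ 2)| ≤ 1 / s * |x.1| := by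
        have hpos : 0 < 1 + s * x.1 ^ 2 := by positivity
        rw [abs_div, abs_of_pos hpos, div_le_iff₀ hpos, abs_pow, ← sq_abs x.1]
        have : 1 / s * |x.1| * (1 + s * |x.1| ^ 2) = 1 / s * |x.1| + |x.1| ^ 3 := by
          field_simp
        rw [this]
        have : 0 ≤ 1 / s * |x.1| := by positivity
        linarith
      have h4 : 1 / s * |x.1| ≤ 1 / s * ‖x‖ := by gcongr
      have h5 : c * |x.2| ≤ c * ‖x‖ := by gcongr
      have h6 : 0 ≤ 1 / s * ‖x‖ := by positivity
      have h7 : 0 ≤ c * ‖x‖ := by positivity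
      rw [Prod.norm_def]
      apply max_le
      · show |x.2| ≤ _
        linarith
      · show |-c * x.2 - x.1 ^ 3 / (1 + s * x.1 ^ 2)| ≤ _
        have h8 := abs_sub (-c * x.2) (x.1 ^ 3 / (1 + s * x.1 ^ 2))
        have h9 : |-c * x.2| = c * |x.2| := by rw [abs_mul, abs_neg, abs_of_pos hc]
        linarith) (1, 0)
  refine ⟨fun t => (γ t).1, fun t => (γ t).2, by simp [h0], fun t => ?_, fun t => ?_⟩
  · exact (hasFDerivAt_fst.comp_hasDerivAt t (h t))
  · exact (hasFDerivAt_snd.comp_hasDerivAt t (h t))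

end

/-- For `0 < c < 2/√s` there exists an unbounded traveling wave of speed `c`
that oscillates infinitely many times: a solution on an interval `(α, +∞)` with
`α ∈ ℝ ∪ {-∞}`, tending to `0` at `+∞`, with infinitely many zeros, and whose
phase-plane norm `φ² + (φ')²` has limsup `+∞` as `ξ → α⁺`. -/
theorem exists_oscillating_unbounded_traveling_wave_below_critical_speed
    (s c : ℝ) (hs : 0 < s) (hc : 0 < c) (hcs : c < 2 / Real.sqrt s) :
    ∃ (α : EReal) (φ : ℝ → ℝ),
      (∀ ξ : ℝ, α < (ξ : EReal) → DifferentiableAt ℝ φ ξ) ∧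
      (∀ ξ : ℝ, α < (ξ : EReal) → DifferentiableAt ℝ (deriv φ) ξ) ∧
      (∀ ξ : ℝ, α < (ξ : EReal) →
        deriv (deriv φ) ξ + c * deriv φ ξ + (φ ξ) ^ 3 / (1 + s * (φ ξ) ^ 2) = 0) ∧
      Tendsto φ atTop (nhds 0) ∧
      {ξ : ℝ | α < (ξ : EReal) ∧ φ ξ = 0}.Infinite ∧
      Filter.limsup (fun ξ : ℝ => (((φ ξ) ^ 2 + (deriv φ ξ) ^ 2 : ℝ) : EReal))
        (Filter.comap (fun x : ℝ => (x : EReal)) (nhdsWithin α (Set.Ioi α))) = ⊤ := by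
  obtain ⟨φ, p, h0, hφ, hp⟩ := tw_field s c hs hc
  have hd : deriv φ = p := funext fun t => (hφ t).deriv
  have hN := tw_growth s c hs hc φ p hφ hp h0
  have hcs' : c ^ 2 / 4 < 1 / s := by
    have h1 : c ^ 2 < (2 / Real.sqrt s) ^ 2 := by gcongr
    rw [div_pow, Real.sq_sqrt hs.le] at h1
    have : (2:ℝ) ^ 2 / s = 4 * (1 / s) := by ring
    linarith
  refine ⟨⊥, φ, fun ξ _ => (hφ ξ).differentiableAt, fun ξ _ => ?_, fun ξ _ => ?_,
    tw_decay s c hs hc φ p hφ hp, ?_, ?_⟩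
  · rw [hd]; exact (hp ξ).differentiableAt
  · rw [hd, (hp ξ).deriv]; ring
  · simpa [EReal.bot_lt_coe] using tw_zeros s c hs hc φ p hφ hp hcs' hN
  · rw [tw_filter, hd]
    exact (EReal.tendsto_coe_nhds_top_iff.2 hN).limsup_eq
end

section
/- Let s > 0 and c ≥ 2/√s. Then there exists a sign-changing unbounded traveling wave of speed c for u_t = u_xx + u³/(1+s u²): a twice differentiable function φ : ℝ → ℝ satisfying φ''(ξ) + c·φ'(ξ) + φ(ξ)³/(1 + s·φ(ξ)²) = 0 for all ξ, with φ(ξ) → +∞ as ξ → -∞ and φ(ξ) → 0 as ξ → +∞, together with a (unique) point ξ* ∈ ℝ such that φ'(ξ) < 0 for all ξ < ξ*, φ'(ξ*) = 0, φ'(ξ) > 0 for all ξ > ξ*, and φ(ξ*) < 0. In particular φ is negative on [ξ*, +∞), and φ vanishes at exactly one point, which lies in (-∞, ξ*). -/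
open Filter Set
open scoped Manifold NNReal

lemma global_ode {E : Type*} [NormedAddCommGroup E] [NormedSpace ℝ E] [CompleteSpace E]
    (v : E → E) (hv : ContDiff ℝ 1 v) (K : ℝ≥0) (hK : LipschitzWith K v) (x : E) :
    ∃ γ : ℝ → E, γ 0 = x ∧ ∀ t, HasDerivAt γ (v (γ t)) t := by
  have hε : (0:ℝ) < 1 / (2 * (K + 1)) := by positivity
  have key := exists_isMIntegralCurve_of_isMIntegralCurveOn (I := 𝓘(ℝ, E)) (M := E) (v := v)
    (contMDiff_vectorSpace_iff_contDiff.2 hv) hε ?_ x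
  · obtain ⟨γ, h0, hγ⟩ := key
    refine ⟨γ, h0, fun t => ?_⟩
    have h1 : HasFDerivAt γ ((1 : ℝ →L[ℝ] ℝ).smulRight (v (γ t))) t :=
      hasMFDerivAt_iff_hasFDerivAt.1 (hγ t)
    simpa using h1.hasDerivAt
  · intro x₀
    set ε : ℝ := 1 / (2 * (K + 1)) with hεd
    have h0 : (0:ℝ) ∈ Icc (-ε) ε := ⟨by linarith, hε.le⟩
    have hPL : IsPicardLindelof (fun _ : ℝ => v) (tmin := -ε) (tmax := ε) ⟨0, h0⟩ x₀
        ‖v x₀‖₊ 0 (‖v x₀‖₊ + K * ‖v x₀‖₊) K := by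
      refine ⟨fun t _ => hK.lipschitzOnWith, fun _ _ => continuousOn_const, ?_, ?_⟩
      · intro t _ y hy
        have h1 := hK.dist_le_mul y x₀
        have h2 : ‖v y‖ ≤ ‖v x₀‖ + dist (v y) (v x₀) := by
          rw [dist_eq_norm]
          have := norm_add_le (v x₀) (v y - v x₀)
          simpa using this
        have h3 : (K:ℝ) * dist y x₀ ≤ K * ‖v x₀‖ :=
          mul_le_mul_of_nonneg_left hy K.2
        push_cast
        linarith
      · simp only [NNReal.coe_add, NNReal.coe_mul, coe_nnnorm, sub_zero, zero_sub, neg_neg, max_self,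
          NNReal.coe_zero]
        rw [hεd, mul_one_div, div_le_iff₀ (by positivity)]
        nlinarith [norm_nonneg (v x₀), K.2, mul_nonneg (norm_nonneg (v x₀)) K.2]
    obtain ⟨α, hα0, hα⟩ := hPL.exists_eq_forall_mem_Icc_hasDerivWithinAt₀
    refine ⟨α, hα0, fun t ht => ?_⟩
    have h1 : HasDerivWithinAt α (v (α t)) (Ioo (-ε) ε) t :=
      (hα t (Ioo_subset_Icc_self ht)).mono Ioo_subset_Icc_self
    have h2 : HasFDerivWithinAt α ((1 : ℝ →L[ℝ] ℝ).smulRight (v (α t))) (Ioo (-ε) ε) t := by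
      have h3 : ((1 : ℝ →L[ℝ] ℝ).smulRight (v (α t))) =
          ContinuousLinearMap.toSpanSingleton ℝ (v (α t)) := by
        ext; simp
      rw [h3]
      exact h1.hasFDerivWithinAt
    exact hasMFDerivWithinAt_iff_hasFDerivWithinAt.2 h2

lemma exists_sol (s c : ℝ) (hs : 0 < s) : ∃ φ ψ : ℝ → ℝ, φ 0 = -1 ∧ ψ 0 = 0 ∧
    (∀ t, HasDerivAt φ (ψ t) t) ∧
    (∀ t, HasDerivAt ψ (-(c * ψ t) - (φ t) ^ 3 / (1 + s * (φ t) ^ 2)) t) := by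
  have hpos : ∀ x : ℝ, 0 < 1 + s * x ^ 2 := fun x => by positivity
  let f : ℝ → ℝ := fun x => x ^ 3 / (1 + s * x ^ 2)
  have hfd : ∀ x, HasDerivAt f ((3 * x ^ 2 + s * x ^ 4) / (1 + s * x ^ 2) ^ 2) x := by
    intro x
    have h1 : HasDerivAt (fun x : ℝ => x ^ 3) (3 * x ^ 2) x := by
      simpa using hasDerivAt_pow 3 x
    have h2 : HasDerivAt (fun x : ℝ => 1 + s * x ^ 2) (s * (2 * x)) x := by
      simpa using ((hasDerivAt_pow 2 x).const_mul s).const_add 1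
    have h3 := h1.div h2 (hpos x).ne'
    refine h3.congr_deriv ?_
    congr 1
    ring
  have hfl : LipschitzWith (Real.toNNReal (2 / s)) f := by
    apply lipschitzWith_of_nnnorm_deriv_le (fun x => (hfd x).differentiableAt)
    intro x
    rw [(hfd x).deriv, ← NNReal.coe_le_coe, coe_nnnorm, Real.coe_toNNReal _ (by positivity),
      Real.norm_of_nonneg (by positivity), div_le_div_iff₀ (by have := hpos x; positivity) hs]
    nlinarith [mul_pos hs hs, sq_nonneg (s * x ^ 2), mul_nonneg hs.le (sq_nonneg x)]
  have hfc : ContDiff ℝ 1 f := by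
    apply ContDiff.div (by fun_prop) (by fun_prop) (fun x => (hpos x).ne')
  let v : ℝ × ℝ → ℝ × ℝ := fun p => (p.2, -(c * p.2) - f p.1)
  have hvc : ContDiff ℝ 1 v := by
    apply ContDiff.prodMk (by fun_prop)
    exact (by fun_prop : ContDiff ℝ 1 fun p : ℝ × ℝ => -(c * p.2)).sub (hfc.comp contDiff_fst)
  have hvl : ∃ K, LipschitzWith K v := by
    have h1 : LipschitzWith 1 (Prod.snd : ℝ × ℝ → ℝ) := LipschitzWith.prod_snd
    have h2 : LipschitzWith _ (fun p : ℝ × ℝ => f p.1) := hfl.comp LipschitzWith.prod_fst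
    have h3 : LipschitzWith ‖-c‖₊ (fun y : ℝ => (-c) * y) := by
      simpa using lipschitzWith_smul (-c) (β := ℝ)
    have h4 := (h3.comp h1).sub h2
    have h5 := h1.prodMk h4
    have h6 : v = fun p : ℝ × ℝ => (p.2, ((fun y : ℝ => -c * y) ∘ Prod.snd) p - f p.1) := by
      ext p <;> simp [v]
    rw [h6]
    exact ⟨_, h5⟩
  obtain ⟨K, hK⟩ := hvl
  obtain ⟨γ, h0, hγ⟩ := global_ode v hvc K hK (-1, 0)
  refine ⟨fun t => (γ t).1, fun t => (γ t).2, by simp [h0], by simp [h0], fun t => ?_, fun t => ?_⟩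
  · exact (hγ t).fst
  · exact (hγ t).snd

lemma aux_mul_neg_iff {a b : ℝ} (hb : 0 < b) : a * b < 0 ↔ a < 0 :=
  ⟨fun h => by by_contra hcon; push Not at hcon; nlinarith [mul_nonneg hcon hb.le],
    fun h => mul_neg_of_neg_of_pos h hb⟩

/-- Main qualitative analysis of the solution. -/
lemma wave_analysis (s c : ℝ) (hs : 0 < s) (hc0 : 0 < c) (hc : 4 ≤ s * c ^ 2) (φ ψ : ℝ → ℝ)
    (hφ0 : φ 0 = -1) (hψ0 : ψ 0 = 0)
    (hφ : ∀ t, HasDerivAt φ (ψ t) t)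
    (hψ : ∀ t, HasDerivAt ψ (-(c * ψ t) - (φ t) ^ 3 / (1 + s * (φ t) ^ 2)) t) :
    Tendsto φ atBot atTop ∧
      Tendsto φ atTop (nhds 0) ∧
      (∀ ξ : ℝ, ξ < 0 → ψ ξ < 0) ∧
      (∀ ξ : ℝ, 0 < ξ → 0 < ψ ξ) ∧
      (∀ ξ : ℝ, 0 ≤ ξ → φ ξ < 0) ∧
      (∃ ξ₀ : ℝ, ξ₀ < 0 ∧ φ ξ₀ = 0 ∧ ∀ ξ : ℝ, φ ξ = 0 → ξ = ξ₀) := by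
  have hpos : ∀ x : ℝ, 0 < 1 + s * x ^ 2 := fun x => by positivity
  have hφc : Continuous φ := continuous_iff_continuousAt.2 fun t => (hφ t).continuousAt
  have hψc : Continuous ψ := continuous_iff_continuousAt.2 fun t => (hψ t).continuousAt
  -- exponential weight
  have hE : ∀ k t : ℝ, HasDerivAt (fun t : ℝ => Real.exp (k * t)) (Real.exp (k * t) * k) t := by
    intro k t
    have := ((hasDerivAt_id t).const_mul k).exp
    simpa using this
  -- P
  let P : ℝ → ℝ := fun t => ψ t * Real.exp (c * t)
  have hP : ∀ t, HasDerivAt P (-(φ t ^ 3 / (1 + s * φ t ^ 2)) * Real.exp (c * t)) t := by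
    intro t
    refine ((hψ t).mul (hE c t)).congr_deriv ?_
    ring
  have hPc : Continuous P := continuous_iff_continuousAt.2 fun t => (hP t).continuousAt
  have hP0 : P 0 = 0 := by simp [P, hψ0]
  have hfneg : ∀ x : ℝ, x < 0 → x ^ 3 / (1 + s * x ^ 2) < 0 := fun x hx =>
    div_neg_of_neg_of_pos (Odd.pow_neg (by decide) hx) (hpos x)
  have hPpos : ∀ t, φ t < 0 → 0 < -(φ t ^ 3 / (1 + s * φ t ^ 2)) * Real.exp (c * t) := by
    intro t ht
    have := hfneg _ ht
    have h2 := Real.exp_pos (c * t)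
    apply mul_pos (by linarith) h2
  -- g, h
  let g : ℝ → ℝ := fun t => φ t * Real.exp (c / 2 * t)
  let h : ℝ → ℝ := fun t => (ψ t + c / 2 * φ t) * Real.exp (c / 2 * t)
  have hg : ∀ t, HasDerivAt g (h t) t := by
    intro t
    refine ((hφ t).mul (hE (c / 2) t)).congr_deriv ?_
    simp only [h]; ring
  have hh : ∀ t, HasDerivAt h ((c ^ 2 / 4 - φ t ^ 2 / (1 + s * φ t ^ 2)) * g t) t := by
    intro t
    refine (((hψ t).add ((hφ t).const_mul (c / 2))).mul (hE (c / 2) t)).congr_deriv ?_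
    simp only [g, Pi.add_apply]; ring
  have hq : ∀ x : ℝ, 0 ≤ c ^ 2 / 4 - x ^ 2 / (1 + s * x ^ 2) := by
    intro x
    rw [sub_nonneg, div_le_div_iff₀ (hpos x) (by norm_num)]
    nlinarith [sq_nonneg x, sq_nonneg c, mul_le_mul_of_nonneg_right hc (sq_nonneg x)]
  have hgc : Continuous g := continuous_iff_continuousAt.2 fun t => (hg t).continuousAt
  have hhc : Continuous h := continuous_iff_continuousAt.2 fun t => (hh t).continuousAt
  have hgh : ∀ t, HasDerivAt (fun t => g t * h t)
      (h t ^ 2 + (c ^ 2 / 4 - φ t ^ 2 / (1 + s * φ t ^ 2)) * g t ^ 2) t := by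
    intro t
    refine ((hg t).mul (hh t)).congr_deriv ?_
    ring
  have hmono : Monotone (fun t => g t * h t) :=
    monotone_of_hasDerivAt_nonneg hgh fun t => by
      have := hq (φ t)
      positivity
  have hgφ : ∀ t, g t < 0 ↔ φ t < 0 := fun t => by
    simp only [g]; exact aux_mul_neg_iff (Real.exp_pos _)
  -- forward
  have hgh0 : g 0 * h 0 = c / 2 := by simp [g, h, hφ0, hψ0]
  have hfwd : ∀ t, 0 ≤ t → φ t < 0 := by
    intro t ht
    by_contra hcon
    push Not at hcon
    obtain ⟨u, hu, hu0⟩ := intermediate_value_Icc ht hφc.continuousOn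
      (show (0:ℝ) ∈ Icc (φ 0) (φ t) from ⟨by rw [hφ0]; norm_num, hcon⟩)
    have h1 : g 0 * h 0 ≤ g u * h u := hmono hu.1
    have h2 : g u = 0 := by simp [g, hu0]
    rw [hgh0, h2] at h1
    linarith
  have hhneg : ∀ t, 0 ≤ t → ψ t + c / 2 * φ t < 0 := by
    intro t ht
    have h1 : g 0 * h 0 ≤ g t * h t := hmono ht
    rw [hgh0] at h1
    have h2 : g t < 0 := (hgφ t).2 (hfwd t ht)
    have h3 : h t < 0 := by
      by_contra hcon
      push Not at hcon
      nlinarith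
    by_contra hcon
    push Not at hcon
    have : 0 ≤ h t := mul_nonneg hcon (Real.exp_pos _).le
    linarith
  have hPpsi : ∀ t, P t < 0 → ψ t < 0 := by
    intro t ht
    exact (aux_mul_neg_iff (Real.exp_pos _)).1 ht
  have hψfwd : ∀ t, 0 < t → 0 < ψ t := by
    intro t ht
    have hsm : StrictMonoOn P (Ici 0) := by
      apply strictMonoOn_of_hasDerivWithinAt_pos (convex_Ici 0) hPc.continuousOn
        (fun x _ => (hP x).hasDerivWithinAt)
      intro x hx
      rw [interior_Ici] at hx
      exact hPpos x (hfwd x hx.le)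
    have h1 := hsm (self_mem_Ici : (0:ℝ) ∈ Ici 0) (show t ∈ Ici (0:ℝ) from ht.le) ht
    rw [hP0] at h1
    exact (mul_pos_iff_of_pos_right (Real.exp_pos _)).1 h1
  have hφmono : MonotoneOn φ (Ici 0) := by
    apply monotoneOn_of_hasDerivWithinAt_nonneg (convex_Ici 0) hφc.continuousOn
      (fun x _ => (hφ x).hasDerivWithinAt)
    intro x hx
    rw [interior_Ici] at hx
    exact (hψfwd x hx).le
  have hlim : Tendsto φ atTop (nhds 0) := by
    rw [tendsto_order]
    refine ⟨fun L hL => ?_, fun b hb => ?_⟩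
    swap
    · filter_upwards [eventually_ge_atTop 0] with t ht
      exact (hfwd t ht).trans hb
    by_contra hcon
    have hall : ∀ t, 0 ≤ t → φ t ≤ L := by
      intro t ht
      by_contra hlt
      push Not at hlt
      apply hcon
      filter_upwards [eventually_ge_atTop t] with u hu
      exact hlt.trans_le (hφmono ht (ht.trans hu : (0:ℝ) ≤ u) hu)
    set m : ℝ := -(L ^ 3) / (1 + s) with hm
    have hL3 : L ^ 3 < 0 := Odd.pow_neg (by decide) hL
    have hmpos : 0 < m := div_pos (by linarith) (by linarith)
    have hf : ∀ t, 0 ≤ t → m ≤ -(φ t ^ 3 / (1 + s * φ t ^ 2)) := by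
      intro t ht
      have h1 := hall t ht
      have h2 : -1 ≤ φ t := by
        rw [← hφ0]; exact hφmono (le_refl (0:ℝ)) ht ht
      have h3 : φ t ^ 3 ≤ L ^ 3 := (Odd.strictMono_pow (by decide)).monotone h1
      have h4 : φ t ^ 2 ≤ 1 := by nlinarith
      rw [hm, ← neg_div]
      apply div_le_div₀ (by linarith) (by linarith) (hpos _)
      nlinarith
    have hlow : MonotoneOn (fun t => ψ t + c * φ t - m * t) (Ici 0) := by
      have hd : ∀ x, HasDerivAt (fun t => ψ t + c * φ t - m * t)
          (-(φ x ^ 3 / (1 + s * φ x ^ 2)) - m) x := by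
        intro x
        refine (((hψ x).add ((hφ x).const_mul c)).sub
          ((hasDerivAt_id x).const_mul m)).congr_deriv ?_
        ring
      apply monotoneOn_of_hasDerivWithinAt_nonneg (convex_Ici 0)
        (continuous_iff_continuousAt.2 fun t => (hd t).continuousAt).continuousOn
        (fun x _ => (hd x).hasDerivWithinAt)
      intro x hx
      rw [interior_Ici] at hx
      have := hf x hx.le
      linarith
    have hT : (0:ℝ) ≤ c / m := by positivity
    have h1 := hlow (le_refl (0:ℝ)) hT hT
    simp only [hφ0, hψ0] at h1
    have h2 : m * (c / m) = c := by field_simp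
    have h3 := hhneg _ hT
    have h4 := hfwd _ hT
    nlinarith
  -- backward: existence of a zero
  have hzero : ∃ t, t < 0 ∧ φ t = 0 := by
    by_contra hcon
    push Not at hcon
    have hneg : ∀ t, t ≤ 0 → φ t < 0 := by
      intro t ht
      by_contra hge
      push Not at hge
      obtain ⟨u, hu, hu0⟩ := intermediate_value_Icc' ht hφc.continuousOn
        (show (0:ℝ) ∈ Icc (φ 0) (φ t) from ⟨by rw [hφ0]; norm_num, hge⟩)
      rcases hu.2.lt_or_eq with hlt | heq
      · exact hcon u hlt hu0
      · rw [heq, hφ0] at hu0; norm_num at hu0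
    have hsm : StrictMonoOn P (Iic 0) := by
      apply strictMonoOn_of_hasDerivWithinAt_pos (convex_Iic 0) hPc.continuousOn
        (fun x _ => (hP x).hasDerivWithinAt)
      intro x hx
      rw [interior_Iic] at hx
      exact hPpos x (hneg x hx.le)
    have hm1 : P (-1) < 0 := by
      rw [← hP0]; exact hsm (by simp) (by simp) (by norm_num)
    have hψle : ∀ t, t ≤ -1 → ψ t ≤ P (-1) := by
      intro t ht
      have h1 : P t ≤ P (-1) :=
        hsm.monotoneOn (show t ≤ 0 by linarith) (show (-1:ℝ) ≤ 0 by norm_num) ht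
      have h2 : Real.exp (c * t) ≤ 1 := Real.exp_le_one_iff.2 (by nlinarith)
      have h3 : ψ t < 0 := hPpsi t (by linarith)
      have h4 : ψ t ≤ P t := by simp only [P]; nlinarith
      linarith
    have hanti : AntitoneOn (fun t => φ t - P (-1) * t) (Iic (-1)) := by
      have hd : ∀ x, HasDerivAt (fun t => φ t - P (-1) * t) (ψ x - P (-1)) x := by
        intro x
        refine ((hφ x).sub ((hasDerivAt_id x).const_mul (P (-1)))).congr_deriv ?_
        ring
      apply antitoneOn_of_hasDerivWithinAt_nonpos (convex_Iic _)
        (continuous_iff_continuousAt.2 fun t => (hd t).continuousAt).continuousOn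
        (fun x _ => (hd x).hasDerivWithinAt)
      intro x hx
      rw [interior_Iic] at hx
      have := hψle x hx.le
      linarith
    have hT : -1 - φ (-1) / P (-1) ≤ -1 := by
      have := div_pos_of_neg_of_neg (hneg (-1) (by norm_num)) hm1
      linarith
    have h1 := hanti hT (le_refl (-1:ℝ)) hT
    have h2 := hneg (-1 - φ (-1) / P (-1)) (by linarith)
    have h3 : P (-1) * (-1 - φ (-1) / P (-1)) = -P (-1) - φ (-1) := by
      rw [mul_sub, mul_div_cancel₀ _ hm1.ne]
      ring
    simp only [h3] at h1
    linarith
  -- the last zero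
  obtain ⟨t₀, ht₀, hφt₀⟩ := hzero
  obtain ⟨z, hz, hzmax⟩ := (isCompact_Icc.inter_right (isClosed_singleton.preimage hφc) :
    IsCompact (Icc t₀ 0 ∩ φ ⁻¹' {0})).exists_isGreatest ⟨t₀, ⟨le_rfl, ht₀.le⟩, hφt₀⟩
  have hφz : φ z = 0 := hz.2
  have hz0 : z < 0 := by
    rcases hz.1.2.lt_or_eq with hlt | heq
    · exact hlt
    · rw [heq, hφ0] at hφz; norm_num at hφz
  have hmid : ∀ t, z < t → t ≤ 0 → φ t < 0 := by
    intro t ht ht0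
    by_contra hge
    push Not at hge
    obtain ⟨u, hu, hu0⟩ := intermediate_value_Icc' ht0 hφc.continuousOn
      (show (0:ℝ) ∈ Icc (φ 0) (φ t) from ⟨by rw [hφ0]; norm_num, hge⟩)
    have : u ≤ z := hzmax ⟨⟨by linarith [hz.1.1, hu.1], hu.2⟩, hu0⟩
    linarith [hu.1]
  have hψmid : ∀ t, z ≤ t → t < 0 → ψ t < 0 := by
    intro t ht ht0
    have hsm : StrictMonoOn P (Icc z 0) := by
      apply strictMonoOn_of_hasDerivWithinAt_pos (convex_Icc z 0) hPc.continuousOn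
        (fun x _ => (hP x).hasDerivWithinAt)
      intro x hx
      rw [interior_Icc] at hx
      exact hPpos x (hmid x hx.1 hx.2.le)
    apply hPpsi
    rw [← hP0]
    exact hsm ⟨ht, ht0.le⟩ ⟨hz0.le, le_rfl⟩ ht0
  have hgz : g z = 0 := by simp [g, hφz]
  have hhz : h z < 0 := by
    have : ψ z < 0 := hψmid z le_rfl hz0
    simp only [h, hφz, mul_zero, add_zero]
    exact mul_neg_of_neg_of_pos this (Real.exp_pos _)
  have hghneg : ∀ t, t < z → g t * h t < 0 := by
    intro t ht
    by_contra hge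
    push Not at hge
    have hconst : ∀ u ∈ Icc t z, g u * h u = 0 := by
      intro u hu
      have h1 : g t * h t ≤ g u * h u := hmono hu.1
      have h2 : g u * h u ≤ g z * h z := hmono hu.2
      rw [hgz, zero_mul] at h2
      linarith
    have hd1 : HasDerivWithinAt (fun t => g t * h t) 0 (Icc t z) z :=
      (hasDerivWithinAt_const z (Icc t z) (0:ℝ)).congr hconst (hconst z ⟨ht.le, le_rfl⟩)
    have hd2 := (hgh z).hasDerivWithinAt (s := Icc t z)
    have heq := (uniqueDiffOn_Icc ht z ⟨ht.le, le_rfl⟩).eq_deriv _ hd1 hd2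
    rw [hgz] at heq
    nlinarith
  have hhneg' : ∀ t, t ≤ z → h t < 0 := by
    intro t ht
    by_contra hge
    push Not at hge
    obtain ⟨u, hu, hu0⟩ := intermediate_value_Icc' ht hhc.continuousOn
      (show (0:ℝ) ∈ Icc (h z) (h t) from ⟨hhz.le, hge⟩)
    rcases hu.2.lt_or_eq with hlt | heq
    · have := hghneg u hlt
      rw [hu0, mul_zero] at this
      exact lt_irrefl _ this
    · rw [heq] at hu0; linarith
  have hgpos : ∀ t, t < z → 0 < g t := by
    intro t ht
    have h1 := hghneg t ht
    have h2 := hhneg' t ht.le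
    by_contra hcon
    push Not at hcon
    nlinarith
  have hφpos : ∀ t, t < z → 0 < φ t := fun t ht =>
    (mul_pos_iff_of_pos_right (Real.exp_pos _)).1 (hgpos t ht)
  have hψbwd : ∀ t, t < 0 → ψ t < 0 := by
    intro t ht
    rcases lt_or_ge t z with hlt | hge
    · have h1 := (aux_mul_neg_iff (Real.exp_pos _)).1 (hhneg' t hlt.le)
      have h2 := hφpos t hlt
      nlinarith
    · exact hψmid t hge ht
  have hganti : AntitoneOn g (Iic z) := by
    apply antitoneOn_of_hasDerivWithinAt_nonpos (convex_Iic _) hgc.continuousOn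
      (fun x _ => (hg x).hasDerivWithinAt)
    intro x hx
    rw [interior_Iic] at hx
    exact (hhneg' x hx.le).le
  have hbot : Tendsto φ atBot atTop := by
    have hδ : 0 < g (z - 1) := hgpos _ (by linarith)
    have ht1 : Tendsto (fun t : ℝ => g (z - 1) * Real.exp (-(c / 2) * t)) atBot atTop := by
      apply Tendsto.const_mul_atTop hδ
      apply Real.tendsto_exp_atTop.comp
      exact tendsto_id.const_mul_atBot_of_neg (by linarith)
    apply tendsto_atTop_mono' _ _ ht1
    filter_upwards [eventually_le_atBot (z - 1)] with t ht
    have h1 : g (z - 1) ≤ g t := hganti (show t ≤ z by linarith) (show z - 1 ≤ z by linarith) ht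
    have h2 : φ t = g t * Real.exp (-(c / 2) * t) := by
      simp only [g]
      rw [mul_assoc, ← Real.exp_add]
      simp
    rw [h2]
    exact mul_le_mul_of_nonneg_right h1 (Real.exp_pos _).le
  refine ⟨hbot, hlim, hψbwd, hψfwd, hfwd, z, hz0, hφz, fun ξ hξ => ?_⟩
  rcases lt_trichotomy ξ z with hlt | heq | hgt
  · have := hφpos ξ hlt; linarith
  · exact heq
  · rcases le_or_gt ξ 0 with hle | hgt0
    · have := hmid ξ hgt hle; linarith
    · have := hfwd ξ hgt0.le; linarith

/-- For `c ≥ 2/√s` there exists a sign-changing unbounded traveling wave of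
speed `c`: a global solution with `φ → +∞` at `-∞`, `φ → 0` at `+∞`, decreasing up to a
unique point `ξ*` where `φ(ξ*) < 0`, increasing afterwards; `φ` is negative on
`[ξ*, +∞)` and vanishes at exactly one point, which lies in `(-∞, ξ*)`. -/
theorem exists_sign_changing_unbounded_traveling_wave
    (s c : ℝ) (hs : 0 < s) (hc : 2 / Real.sqrt s ≤ c) :
    ∃ (φ : ℝ → ℝ) (ξstar : ℝ),
      (∀ ξ : ℝ, DifferentiableAt ℝ φ ξ) ∧
      (∀ ξ : ℝ, DifferentiableAt ℝ (deriv φ) ξ) ∧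
      (∀ ξ : ℝ, deriv (deriv φ) ξ + c * deriv φ ξ + (φ ξ) ^ 3 / (1 + s * (φ ξ) ^ 2) = 0) ∧
      Tendsto φ atBot atTop ∧
      Tendsto φ atTop (nhds 0) ∧
      (∀ ξ : ℝ, ξ < ξstar → deriv φ ξ < 0) ∧
      deriv φ ξstar = 0 ∧
      (∀ ξ : ℝ, ξstar < ξ → 0 < deriv φ ξ) ∧
      φ ξstar < 0 ∧
      (∀ ξ : ℝ, ξstar ≤ ξ → φ ξ < 0) ∧
      (∃ ξ₀ : ℝ, ξ₀ < ξstar ∧ φ ξ₀ = 0 ∧ ∀ ξ : ℝ, φ ξ = 0 → ξ = ξ₀) := by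
  have hsq : 0 < Real.sqrt s := Real.sqrt_pos.2 hs
  have hc0 : 0 < c := lt_of_lt_of_le (by positivity) hc
  have hc4 : 4 ≤ s * c ^ 2 := by
    have h1 : 2 ≤ c * Real.sqrt s := (div_le_iff₀ hsq).1 hc
    have h2 := Real.sq_sqrt hs.le
    nlinarith
  obtain ⟨φ, ψ, hφ0, hψ0, hφ, hψ⟩ := exists_sol s c hs
  obtain ⟨hbot, htop, hneg, hpos, hφneg, hz⟩ := wave_analysis s c hs hc0 hc4 φ ψ hφ0 hψ0 hφ hψ
  have hd : deriv φ = ψ := funext fun t => (hφ t).deriv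
  refine ⟨φ, 0, fun t => (hφ t).differentiableAt, ?_, ?_, hbot, htop, ?_, ?_, ?_, ?_, hφneg, hz⟩
  · rw [hd]; exact fun t => (hψ t).differentiableAt
  · intro t
    rw [hd, (hψ t).deriv]; ring
  · rw [hd]; exact hneg
  · rw [hd]; exact hψ0
  · rw [hd]; exact hpos
  · rw [hφ0]; norm_num
end

section
/- Let s > 0 and c > 0. If φ : ℝ → ℝ is twice differentiable, satisfies φ''(ξ) + c·φ'(ξ) + φ(ξ)³/(1 + s·φ(ξ)²) = 0 for all ξ ∈ ℝ, and both φ and φ' are bounded on ℝ, then φ is identically zero. In particular the equation u_t = u_xx + u³/(1+s u²) admits no nonconstant bounded traveling wave solutions (and hence no front-type traveling waves). -/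
open Filter

/-- Every bounded global solution of the traveling-wave ODE (with bounded
derivative) is identically zero; hence there are no nonconstant bounded traveling waves,
in particular no front-type traveling waves. -/
theorem bounded_traveling_wave_is_zero
    (s c : ℝ) (hs : 0 < s) (hc : 0 < c)
    (φ : ℝ → ℝ)
    (hφ : ∀ ξ : ℝ, DifferentiableAt ℝ φ ξ)
    (hφ' : ∀ ξ : ℝ, DifferentiableAt ℝ (deriv φ) ξ)
    (hode : ∀ ξ : ℝ, deriv (deriv φ) ξ + c * deriv φ ξ + (φ ξ) ^ 3 / (1 + s * (φ ξ) ^ 2) = 0)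
    (hbdd : ∃ M : ℝ, ∀ ξ : ℝ, |φ ξ| ≤ M ∧ |deriv φ ξ| ≤ M) :
    ∀ ξ : ℝ, φ ξ = 0 := by
  obtain ⟨M, hM⟩ := hbdd
  have hpos : ∀ u : ℝ, 0 < 1 + s * u ^ 2 := fun u => by positivity
  set F : ℝ → ℝ := fun u => u ^ 2 / (2 * s) - Real.log (1 + s * u ^ 2) / (2 * s ^ 2) with hF
  set f : ℝ → ℝ := fun u => u ^ 3 / (1 + s * u ^ 2) with hf
  have hFd : ∀ u, HasDerivAt F (f u) u := by
    intro u
    have h1 : HasDerivAt (fun u : ℝ => u ^ 2) (2 * u) u := by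
      simpa using hasDerivAt_pow 2 u
    have h2 := ((h1.const_mul s).const_add 1).log (hpos u).ne'
    have h3 := (h1.div_const (2 * s)).sub (h2.div_const (2 * s ^ 2))
    refine h3.congr_deriv ?_
    have := (hpos u).ne'
    simp only [hf]
    field_simp
    ring
  have hFle : ∀ u, F u ≤ u * f u := by
    intro u
    have h := Real.one_sub_inv_le_log_of_pos (hpos u)
    have h1 : Real.log (1 + s * u ^ 2) / (2 * s ^ 2) ≥ (1 - (1 + s * u ^ 2)⁻¹) / (2 * s ^ 2) := by
      gcongr
    have h2 : u ^ 2 / (2 * s) - (1 - (1 + s * u ^ 2)⁻¹) / (2 * s ^ 2)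
        = (u ^ 4 / (1 + s * u ^ 2)) / 2 := by
      have := (hpos u).ne'
      field_simp
      ring
    have h3 : u * f u = u ^ 4 / (1 + s * u ^ 2) := by simp only [hf]; ring
    have h4 : 0 ≤ u ^ 4 / (1 + s * u ^ 2) := by have := hpos u; positivity
    rw [h3]
    simp only [hF]
    linarith
  have hFpos : ∀ u, u ≠ 0 → 0 < F u := by
    intro u hu
    have h0 : 0 < s * u ^ 2 := by positivity
    have h := Real.log_lt_sub_one_of_pos (hpos u) (by linarith)
    have h1 : Real.log (1 + s * u ^ 2) / (2 * s ^ 2) < (s * u ^ 2) / (2 * s ^ 2) := by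
      gcongr; linarith
    have h2 : (s * u ^ 2) / (2 * s ^ 2) = u ^ 2 / (2 * s) := by field_simp
    simp only [hF]
    linarith
  have hFub : ∀ u, F u ≤ u ^ 2 / (2 * s) := by
    intro u
    have h0 : 0 ≤ Real.log (1 + s * u ^ 2) := Real.log_nonneg (by nlinarith [sq_nonneg u])
    have h1 : 0 ≤ Real.log (1 + s * u ^ 2) / (2 * s ^ 2) := by positivity
    simp only [hF]
    linarith
  set E : ℝ → ℝ := fun x => (deriv φ x) ^ 2 / 2 + F (φ x) with hE
  have hode' : ∀ x, deriv (deriv φ) x = - c * deriv φ x - f (φ x) := by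
    intro x
    have := hode x
    simp only [hf]
    linarith
  have hEd : ∀ x, HasDerivAt E (- c * (deriv φ x) ^ 2) x := by
    intro x
    have h := (((hφ' x).hasDerivAt.pow 2).div_const 2).add
      ((hFd (φ x)).comp x (hφ x).hasDerivAt)
    refine h.congr_deriv ?_
    rw [hode' x]
    push_cast
    ring
  have hEanti : Antitone E := antitone_of_hasDerivAt_nonpos hEd (fun x => by
    show - c * (deriv φ x) ^ 2 ≤ 0
    nlinarith [mul_nonneg hc.le (sq_nonneg (deriv φ x))])
  intro x₀
  by_contra hne
  have hE0 : 0 < E x₀ := by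
    have := hFpos _ hne
    simp only [hE]
    positivity
  set K : ℝ → ℝ := fun x => 3 / (2 * c) * E x + φ x * deriv φ x + c / 2 * (φ x) ^ 2 + E x₀ * x
    with hK
  have hKd : ∀ x, HasDerivAt K (-(deriv φ x) ^ 2 / 2 - φ x * f (φ x) + E x₀) x := by
    intro x
    have h := ((((hEd x).const_mul (3 / (2 * c))).add
      ((hφ x).hasDerivAt.mul (hφ' x).hasDerivAt)).add
      (((hφ x).hasDerivAt.pow 2).const_mul (c / 2))).add ((hasDerivAt_id x).const_mul (E x₀))
    refine h.congr_deriv ?_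
    rw [hode' x]
    push_cast
    field_simp
    ring
  have hKanti : AntitoneOn K (Set.Iic x₀) := by
    refine antitoneOn_of_deriv_nonpos (convex_Iic x₀)
      (fun x _ => (hKd x).continuousAt.continuousWithinAt)
      (fun x _ => (hKd x).differentiableAt.differentiableWithinAt) ?_
    intro x hx
    rw [interior_Iic] at hx
    rw [(hKd x).deriv]
    have h1 : E x₀ ≤ (deriv φ x) ^ 2 / 2 + F (φ x) := hEanti (le_of_lt hx)
    have h2 := hFle (φ x)
    linarith
  have hHub : ∀ x, 3 / (2 * c) * E x + φ x * deriv φ x + c / 2 * (φ x) ^ 2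
      ≤ 3 / (2 * c) * (M ^ 2 / 2 + M ^ 2 / (2 * s)) + M ^ 2 + c / 2 * M ^ 2 := by
    intro x
    obtain ⟨ha, hb⟩ := hM x
    have h1 : (φ x) ^ 2 ≤ M ^ 2 := sq_le_sq' (abs_le.mp ha).1 (abs_le.mp ha).2
    have h2 : (deriv φ x) ^ 2 ≤ M ^ 2 := sq_le_sq' (abs_le.mp hb).1 (abs_le.mp hb).2
    have h3 : φ x * deriv φ x ≤ M ^ 2 := by nlinarith [sq_nonneg (φ x - deriv φ x)]
    have h4 : E x ≤ M ^ 2 / 2 + M ^ 2 / (2 * s) := by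
      have h5 : (φ x) ^ 2 / (2 * s) ≤ M ^ 2 / (2 * s) := by gcongr
      have h6 := hFub (φ x)
      simp only [hE]
      linarith
    gcongr
  set B := 3 / (2 * c) * (M ^ 2 / 2 + M ^ 2 / (2 * s)) + M ^ 2 + c / 2 * M ^ 2
  have key : ∀ x, x ≤ x₀ → K x₀ ≤ B + E x₀ * x := by
    intro x hx
    have h1 : K x₀ ≤ K x := hKanti hx (le_refl x₀) hx
    have h2 := hHub x
    have h3 : K x = 3 / (2 * c) * E x + φ x * deriv φ x + c / 2 * (φ x) ^ 2 + E x₀ * x := rfl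
    linarith
  have h1 := key (min x₀ ((K x₀ - B - 1) / E x₀)) (min_le_left _ _)
  have h2 : E x₀ * min x₀ ((K x₀ - B - 1) / E x₀) ≤ E x₀ * ((K x₀ - B - 1) / E x₀) :=
    mul_le_mul_of_nonneg_left (min_le_right _ _) hE0.le
  rw [mul_div_cancel₀ _ hE0.ne'] at h2
  linarith
end

section
/- Let s > 0 and c = 2/√s. Then every positive unbounded traveling wave φ of speed c — a twice differentiable φ : ℝ → ℝ with φ > 0, solving φ'' + cφ' + φ³/(1+sφ²) = 0 on ℝ, with φ(ξ) → +∞ as ξ → -∞ and φ(ξ) → 0 as ξ → +∞ — satisfies φ'(ξ)/φ(ξ) → -1/√s as ξ → -∞. -/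
open Filter

lemma barrier_aux (g g' : ℝ → ℝ) (hg : ∀ t, HasDerivAt g (g' t) t) (b t₀ : ℝ)
    (h0 : b ≤ g t₀) (hb : ∀ t, t₀ ≤ t → g t = b → 0 < g' t) :
    ∀ t, t₀ ≤ t → b ≤ g t := by
  intro t ht
  exact image_le_of_deriv_right_lt_deriv_boundary (f := fun _ => b) (f' := fun _ => 0)
    (a := t₀) (b := t) continuousOn_const (fun x _ => hasDerivWithinAt_const _ _ _) h0 hg
    (fun x hx h => hb x hx.1 h.symm) (Set.right_mem_Icc.2 ht)

lemma growth_aux (g g' : ℝ → ℝ) (t₀ k : ℝ) (hg : ∀ t, t₀ ≤ t → HasDerivAt g (g' t) t)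
    (hk : ∀ t, t₀ ≤ t → k ≤ g' t) :
    ∀ t, t₀ ≤ t → g t₀ + k * (t - t₀) ≤ g t := by
  intro t ht
  have hm : MonotoneOn (fun x => g x - k * x) (Set.Ici t₀) := by
    have hd : ∀ x, t₀ ≤ x → HasDerivAt (fun x => g x - k * x) (g' x - k) x := by
      intro x hx
      exact HasDerivAt.congr_deriv ((hg x hx).sub ((hasDerivAt_id x).const_mul k)) (by ring)
    apply monotoneOn_of_deriv_nonneg (convex_Ici _)
    · exact fun x hx => (hd x hx).continuousAt.continuousWithinAt
    · intro x hx
      rw [interior_Ici] at hx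
      exact (hd x (le_of_lt hx)).differentiableAt.differentiableWithinAt
    · intro x hx
      rw [interior_Ici] at hx
      rw [(hd x (le_of_lt hx)).deriv]
      linarith [hk x (le_of_lt hx)]
  have := hm (Set.mem_Ici.2 le_rfl) (Set.mem_Ici.2 ht) ht
  simp only at this
  linarith

lemma riccati_aux (g e : ℝ → ℝ) (hg : ∀ t, HasDerivAt g (g t ^ 2 - e t) t)
    (he : Tendsto e atTop (nhds 0)) : Tendsto g atTop (nhds 0) := by
  rw [Metric.tendsto_atTop]
  intro r hr
  obtain ⟨δ, hδ, hδr⟩ := exists_between hr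
  have hd2 : 0 < δ ^ 2 / 2 := by positivity
  obtain ⟨T, hT⟩ := eventually_atTop.1 (he.eventually (gt_mem_nhds hd2))
  -- upper bound
  have hup : ∀ t, T ≤ t → g t < δ := by
    intro t₀ ht₀
    by_contra! hcon
    have hge := barrier_aux g _ hg δ t₀ hcon (by
      intro t ht h
      have := hT t (ht₀.trans ht)
      rw [h]; linarith)
    have hgr := growth_aux (fun t => -(g t)⁻¹) (fun t => (g t ^ 2 - e t) / g t ^ 2) t₀ (1/2)
      (by
        intro t ht
        have hp : g t ≠ 0 := (hδ.trans_le (hge t ht)).ne'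
        have := ((hg t).inv hp).neg
        exact HasDerivAt.congr_deriv this (by ring))
      (by
        intro t ht
        have h1 := hge t ht
        have hp : 0 < g t := hδ.trans_le h1
        have := hT t (ht₀.trans ht)
        rw [le_div_iff₀ (by positivity)]
        nlinarith)
    have hp0 : 0 < g t₀ := hδ.trans_le hcon
    have hi : 0 < (g t₀)⁻¹ := inv_pos.2 hp0
    have h1 := hgr (t₀ + 2 * (g t₀)⁻¹) (by linarith)
    have h2 : 0 < (g (t₀ + 2 * (g t₀)⁻¹))⁻¹ :=
      inv_pos.2 (hδ.trans_le (hge _ (by linarith)))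
    linarith
  have hlow : ∃ t₁, T ≤ t₁ ∧ -δ ≤ g t₁ := by
    by_contra! hcon
    have hgr := growth_aux g _ T (δ ^ 2 / 2) (fun t _ => hg t) (by
      intro t ht
      have := hcon t ht
      have := hT t ht
      nlinarith)
    have h0 := hcon T le_rfl
    have hq : 0 ≤ -g T / (δ ^ 2 / 2) := div_nonneg (by linarith) hd2.le
    have h1 := hgr (T + -g T / (δ ^ 2 / 2)) (by linarith)
    have h2 := hcon (T + -g T / (δ ^ 2 / 2)) (by linarith)
    have h3 : δ ^ 2 / 2 * (T + -g T / (δ ^ 2 / 2) - T) = - g T := by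
      field_simp
      ring
    linarith
  obtain ⟨t₁, ht₁, hg₁⟩ := hlow
  have hge := barrier_aux g _ hg (-δ) t₁ hg₁ (by
      intro t ht h
      have := hT t (ht₁.trans ht)
      rw [h]; linarith [neg_sq δ])
  refine ⟨t₁, fun t ht => ?_⟩
  rw [Real.dist_eq, sub_zero, abs_lt]
  constructor
  · linarith [hge t ht]
  · linarith [hup t (ht₁.trans ht)]

/-- At the critical speed `c = 2/√s`, every positive unbounded traveling
wave satisfies `φ'/φ → -1/√s` as `ξ → -∞`. -/
theorem log_slope_at_critical_speed
    (s c : ℝ) (hs : 0 < s) (hc : c = 2 / Real.sqrt s)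
    (φ : ℝ → ℝ)
    (hφ : ∀ ξ : ℝ, DifferentiableAt ℝ φ ξ)
    (hφ' : ∀ ξ : ℝ, DifferentiableAt ℝ (deriv φ) ξ)
    (hpos : ∀ ξ : ℝ, 0 < φ ξ)
    (hode : ∀ ξ : ℝ, deriv (deriv φ) ξ + c * deriv φ ξ + (φ ξ) ^ 3 / (1 + s * (φ ξ) ^ 2) = 0)
    (hlim₁ : Tendsto φ atBot atTop)
    (hlim₂ : Tendsto φ atTop (nhds 0)) :
    Tendsto (fun ξ => deriv φ ξ / φ ξ) atBot (nhds (-1 / Real.sqrt s)) := by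
  obtain ⟨a, ha⟩ : ∃ a, a = 1 / Real.sqrt s := ⟨_, rfl⟩
  have hca : c = 2 * a := by rw [hc, ha]; ring
  have ha2 : a ^ 2 = 1 / s := by rw [ha, div_pow, Real.sq_sqrt hs.le, one_pow]
  have key := riccati_aux (fun t => deriv φ (-t) / φ (-t) + a)
    (fun t => (s * (1 + s * φ (-t) ^ 2))⁻¹) (by
      intro t
      have hp := hpos (-t)
      have h1 : HasDerivAt (fun ξ => deriv φ ξ / φ ξ + a)
          ((deriv (deriv φ) (-t) * φ (-t) - deriv φ (-t) * deriv φ (-t)) / φ (-t) ^ 2) (-t) :=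
        (((hφ' (-t)).hasDerivAt).div (hφ (-t)).hasDerivAt hp.ne').add_const a
      have h2 := h1.comp t (hasDerivAt_neg t)
      refine HasDerivAt.congr_deriv h2 ?_
      have h3 : deriv (deriv φ) (-t) =
        -(2 * a * deriv φ (-t)) - (φ (-t)) ^ 3 / (1 + s * (φ (-t)) ^ 2) := by
        have := hode (-t)
        rw [hca] at this
        linarith
      rw [h3, add_sq, ha2]
      have hq : 0 < 1 + s * φ (-t) ^ 2 := by positivity
      field_simp
      ring) (by
      apply Tendsto.inv_tendsto_atTop
      apply Tendsto.const_mul_atTop hs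
      apply tendsto_atTop_add_const_left
      apply Tendsto.const_mul_atTop hs
      exact (tendsto_pow_atTop two_ne_zero).comp (hlim₁.comp tendsto_neg_atTop_atBot))
  have h := (key.comp tendsto_neg_atBot_atTop).add_const (-a)
  have e1 : -1 / Real.sqrt s = 0 + -a := by rw [ha]; ring
  rw [e1]
  refine h.congr fun x => ?_
  simp
end

section
/- Let s > 0 and c > 2/√s, and set M₋ = (-cs - √(c²s² - 4s))/(2s) and M₊ = (-cs + √(c²s² - 4s))/(2s). Then every positive unbounded traveling wave φ of speed c — a twice differentiable φ : ℝ → ℝ with φ > 0, solving φ'' + cφ' + φ³/(1+sφ²) = 0 on ℝ, with φ(ξ) → +∞ as ξ → -∞ and φ(ξ) → 0 as ξ → +∞ — satisfies either φ'(ξ)/φ(ξ) → M₋ or φ'(ξ)/φ(ξ) → M₊ as ξ → -∞; i.e., there are exactly two types of positive unbounded traveling waves of speed c. -/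
open Filter

/-- Escape lemma: if `f' ≥ κ > 0` whenever `a ≤ f ≤ b`, and `f` is once above `a`,
then `f` is eventually above `b`. -/
lemma escape_aux (f f' : ℝ → ℝ) (hf : ∀ t, HasDerivAt f (f' t) t) (a b κ T t0 : ℝ)
    (hκ : 0 < κ) (hab : a ≤ b) (h : ∀ t, T ≤ t → a ≤ f t → f t ≤ b → κ ≤ f' t)
    (ht0 : T ≤ t0) (ha : a ≤ f t0) : ∀ᶠ t in atTop, b ≤ f t := by
  have hcont : Continuous f := continuous_iff_continuousAt.2 fun t => (hf t).continuousAt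
  have trap : ∀ B, a ≤ B → B ≤ b → ∀ t1, T ≤ t1 → B ≤ f t1 → ∀ t, t1 ≤ t → B ≤ f t := by
    intro B haB hBb t1 ht1 hB t ht
    have := image_le_of_deriv_right_lt_deriv_boundary' (f := fun t => - f t)
      (f' := fun t => - f' t) (a := t1) (b := t) (B := fun _ => -B) (B' := fun _ => 0)
      hcont.neg.continuousOn (fun x _ => (hf x).neg.hasDerivWithinAt) (by simpa using hB)
      continuousOn_const (fun x _ => hasDerivWithinAt_const _ _ _)
      (by
        intro x hx hxe
        have hxe' : f x = B := by simpa using hxe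
        have := h x (ht1.trans hx.1) (by linarith) (by linarith)
        linarith)
      (x := t) ⟨ht, le_rfl⟩
    simpa using this
  by_cases hex : ∃ t1, t0 ≤ t1 ∧ b ≤ f t1
  · obtain ⟨t1, h1, h2⟩ := hex
    filter_upwards [eventually_ge_atTop t1] with t ht
    exact trap b hab le_rfl t1 (ht0.trans h1) h2 t ht
  · push Not at hex
    exfalso
    have hlow := trap a le_rfl hab t0 ht0 ha
    have hlin : ∀ t, t0 ≤ t → κ * (t - t0) ≤ f t - f t0 := by
      intro t ht
      refine (convex_Ici t0).mul_sub_le_image_sub_of_le_deriv hcont.continuousOn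
        (fun x _ => (hf x).differentiableAt.differentiableWithinAt) ?_ t0 (by simp) t ht ht
      intro x hx
      rw [interior_Ici] at hx
      have hx' : t0 ≤ x := le_of_lt hx
      rw [(hf x).deriv]
      exact h x (ht0.trans hx') (hlow x hx') (hex x hx').le
    have h3 : t0 ≤ t0 + (b - a) / κ := by
      have : 0 ≤ (b - a) / κ := div_nonneg (by linarith) hκ.le
      linarith
    have h4 := hlin _ h3
    have h5 := hex _ h3
    have h6 : κ * (t0 + (b - a) / κ - t0) = b - a := by field_simp; ring
    linarith

/-- Abstract dichotomy for `z' = (z - m)(z - M) - e` with `e → 0`. -/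
lemma dichotomy_aux (z e : ℝ → ℝ) (m M : ℝ) (hmM : m < M)
    (hz : ∀ t, HasDerivAt z ((z t - m) * (z t - M) - e t) t)
    (he : Tendsto e atTop (nhds 0))
    (hno : ¬ ∀ᶠ t in atTop, 0 ≤ z t) :
    Tendsto z atTop (nhds m) ∨ Tendsto z atTop (nhds M) := by
  have hsmall : ∀ ε > 0, ∃ T, ∀ t, T ≤ t → |e t| < ε ^ 2 / 2 := by
    intro ε hε
    have := (Metric.tendsto_nhds.1 he) (ε ^ 2 / 2) (by positivity)
    simpa [Real.dist_eq] using eventually_atTop.1 this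
  have hup : ∀ ε > 0, ∀ᶠ t in atTop, z t < M + ε := by
    intro ε hε
    obtain ⟨T, hT⟩ := hsmall ε hε
    filter_upwards [eventually_ge_atTop T] with t0 ht0
    by_contra hcon
    push Not at hcon
    refine hno ?_
    have := escape_aux z _ hz (M + ε) (max 0 (M + ε)) (ε ^ 2 / 2) T t0 (by positivity)
      (le_max_right _ _) (by
        intro t ht h1 _
        have := (abs_lt.1 (hT t ht)).2
        nlinarith [mul_nonneg (by linarith : (0:ℝ) ≤ z t - M - ε)
          (by linarith : (0:ℝ) ≤ z t - m), mul_nonneg hε.le (by linarith : (0:ℝ) ≤ z t - m - ε)])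
      ht0 hcon
    filter_upwards [this] with t ht
    exact (le_max_left _ _).trans ht
  by_cases hM : Tendsto z atTop (nhds M)
  · exact Or.inr hM
  left
  have : ∃ ε > 0, ∃ᶠ t in atTop, z t ≤ M - ε := by
    by_contra hcon
    push Not at hcon
    refine hM (Metric.tendsto_nhds.2 ?_)
    intro ε hε
    have h1 := hcon ε hε
    filter_upwards [h1, hup ε hε] with t h1 h2
    rw [Real.dist_eq, abs_lt]
    constructor <;> linarith
  obtain ⟨ε, hε, hfreq⟩ := this
  refine Metric.tendsto_nhds.2 ?_
  intro δ hδ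
  obtain ⟨η, hη, hηδ, hηε, hηD⟩ : ∃ η > 0, η < δ ∧ η ≤ ε ∧ 2 * η ≤ M - m := by
    refine ⟨min (δ / 2) (min ε ((M - m) / 2)), ?_, ?_, ?_, ?_⟩
    · have : 0 < (M - m) / 2 := by linarith
      positivity
    · exact (min_le_left _ _).trans_lt (by linarith)
    · exact (min_le_right _ _).trans (min_le_left _ _)
    · have : min (δ / 2) (min ε ((M - m) / 2)) ≤ (M - m) / 2 :=
        (min_le_right _ _).trans (min_le_right _ _)
      linarith
  obtain ⟨T, hT⟩ := hsmall η hη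
  obtain ⟨t0, ht0, hz0⟩ := (frequently_atTop.1 hfreq) T
  have hhi := escape_aux (fun t => - z t) _ (fun t => (hz t).neg) (-(M - η)) (-(m + η))
    (η ^ 2 / 2) T t0 (by positivity) (by linarith) (by
      intro t ht h1 h2
      have := (abs_lt.1 (hT t ht)).1
      nlinarith [mul_nonneg (by linarith : (0:ℝ) ≤ M - η - z t)
          (by linarith : (0:ℝ) ≤ z t - m),
          mul_nonneg hη.le (by linarith : (0:ℝ) ≤ z t - m - η)])
    ht0 (by linarith)
  have hlo := escape_aux z _ hz (min (z T) (m - η)) (m - η)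
    (η ^ 2 / 2) T T (by positivity) (min_le_right _ _) (by
      intro t ht h1 h2
      have := (abs_lt.1 (hT t ht)).2
      nlinarith [mul_nonneg (by linarith : (0:ℝ) ≤ m - η - z t)
          (by linarith : (0:ℝ) ≤ M - z t),
          mul_nonneg hη.le (by linarith : (0:ℝ) ≤ M - z t - η)])
    le_rfl (min_le_left _ _)
  filter_upwards [hhi, hlo] with t h1 h2
  rw [Real.dist_eq, abs_lt]
  constructor <;> linarith

/-- For `c > 2/√s`, every positive unbounded traveling wave of speed `c`
satisfies either `φ'/φ → M₋` or `φ'/φ → M₊` as `ξ → -∞`, where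
`M± = (-cs ± √(c²s² - 4s))/(2s)`; i.e. there are exactly two types. -/
theorem log_slope_dichotomy_above_critical_speed
    (s c : ℝ) (hs : 0 < s) (hc : 2 / Real.sqrt s < c)
    (φ : ℝ → ℝ)
    (hφ : ∀ ξ : ℝ, DifferentiableAt ℝ φ ξ)
    (hφ' : ∀ ξ : ℝ, DifferentiableAt ℝ (deriv φ) ξ)
    (hpos : ∀ ξ : ℝ, 0 < φ ξ)
    (hode : ∀ ξ : ℝ, deriv (deriv φ) ξ + c * deriv φ ξ + (φ ξ) ^ 3 / (1 + s * (φ ξ) ^ 2) = 0)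
    (hlim₁ : Tendsto φ atBot atTop)
    (hlim₂ : Tendsto φ atTop (nhds 0)) :
    Tendsto (fun ξ => deriv φ ξ / φ ξ) atBot
        (nhds ((-c * s - Real.sqrt (c ^ 2 * s ^ 2 - 4 * s)) / (2 * s))) ∨
    Tendsto (fun ξ => deriv φ ξ / φ ξ) atBot
        (nhds ((-c * s + Real.sqrt (c ^ 2 * s ^ 2 - 4 * s)) / (2 * s))) := by
  have hsq : 0 < Real.sqrt s := Real.sqrt_pos.2 hs
  have hss : Real.sqrt s ^ 2 = s := Real.sq_sqrt hs.le
  have hc2 : 4 < c ^ 2 * s := by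
    have h1 : 2 < c * Real.sqrt s := (div_lt_iff₀ hsq).1 hc
    have h2 : (c * Real.sqrt s) ^ 2 = c ^ 2 * s := by rw [mul_pow, hss]
    nlinarith
  have hdisc : 0 < c ^ 2 * s ^ 2 - 4 * s := by nlinarith
  set r := Real.sqrt (c ^ 2 * s ^ 2 - 4 * s) with hr
  have hrpos : 0 < r := Real.sqrt_pos.2 hdisc
  have hr2 : r ^ 2 = c ^ 2 * s ^ 2 - 4 * s := Real.sq_sqrt hdisc.le
  set m := (-c * s - r) / (2 * s) with hm
  set M := (-c * s + r) / (2 * s) with hMdef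
  have hmM : m < M := by
    rw [hm, hMdef]
    gcongr
    linarith
  have hpoly : ∀ y : ℝ, (y - m) * (y - M) = y ^ 2 + c * y + 1 / s := by
    intro y
    have h1 : m + M = -c := by rw [hm, hMdef]; field_simp; ring
    have h2 : m * M = 1 / s := by
      rw [hm, hMdef, div_mul_div_comm, div_eq_div_iff (by positivity) (by positivity)]
      linear_combination (-s) * hr2
    linear_combination (-y) * h1 + h2
  have hneg : Tendsto (fun t : ℝ => φ (-t)) atTop atTop := hlim₁.comp tendsto_neg_atTop_atBot
  have key := dichotomy_aux (fun t => deriv φ (-t) / φ (-t))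
    (fun t => 1 / (s * (1 + s * φ (-t) ^ 2))) m M hmM ?_ ?_ ?_
  · have back : ∀ L, Tendsto (fun t => deriv φ (-t) / φ (-t)) atTop (nhds L) →
        Tendsto (fun ξ => deriv φ ξ / φ ξ) atBot (nhds L) := by
      intro L hL
      have := hL.comp tendsto_neg_atBot_atTop
      simpa [Function.comp_def] using this
    exact key.imp (back m) (back M)
  · intro t
    have hd1 : HasDerivAt (fun t => φ (-t)) (-deriv φ (-t)) t := by
      simpa [Function.comp_def] using (hφ (-t)).hasDerivAt.comp t (hasDerivAt_neg t)
    have hd2 : HasDerivAt (fun t => deriv φ (-t)) (-deriv (deriv φ) (-t)) t := by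
      simpa [Function.comp_def] using (hφ' (-t)).hasDerivAt.comp t (hasDerivAt_neg t)
    have hp := hpos (-t)
    have hq := hd2.div hd1 hp.ne'
    refine hq.congr_deriv ?_
    have ho := hode (-t)
    have ho' : deriv (deriv φ) (-t) =
      -(c * deriv φ (-t)) - φ (-t) ^ 3 / (1 + s * φ (-t) ^ 2) := by linarith
    rw [ho', hpoly]
    have hden : (1 + s * φ (-t) ^ 2) ≠ 0 := by positivity
    have hp' := hp.ne'
    field_simp
    ring
  · have h1 : Tendsto (fun t : ℝ => s * (1 + s * φ (-t) ^ 2)) atTop atTop := by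
      refine Tendsto.const_mul_atTop hs (tendsto_atTop_add_const_left _ _ ?_)
      exact Tendsto.const_mul_atTop hs ((tendsto_pow_atTop (by norm_num)).comp hneg)
    simp only [one_div]
    exact h1.inv_tendsto_atTop
  · intro hev
    obtain ⟨T, hT⟩ := eventually_atTop.1 hev
    have hmono : MonotoneOn φ (Set.Iic (-T)) := by
      refine monotoneOn_of_deriv_nonneg (convex_Iic _)
        (fun x _ => (hφ x).continuousAt.continuousWithinAt)
        (fun x _ => (hφ x).differentiableWithinAt) ?_
      intro x hx
      rw [interior_Iic] at hx
      have hx' : x < -T := hx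
      have h1 := hT (-x) (by linarith)
      simp only [neg_neg] at h1
      have h2 := mul_nonneg h1 (hpos x).le
      rwa [div_mul_cancel₀ _ (hpos x).ne'] at h2
    obtain ⟨x, hx1, hx2⟩ := ((hlim₁.eventually_gt_atTop (φ (-T))).and
      (eventually_le_atBot (-T))).exists
    have := hmono (show x ∈ Set.Iic (-T) from hx2) (Set.mem_Iic.2 le_rfl) hx2
    linarith
end

section
/- Let s > 0 and c ≥ 2/√s. Then every positive unbounded traveling wave of speed c is strictly decreasing: if φ : ℝ → ℝ is twice differentiable with φ(ξ) > 0 for all ξ, satisfies φ'' + cφ' + φ³/(1+sφ²) = 0 on ℝ, and φ(ξ) → +∞ as ξ → -∞ while φ(ξ) → 0 as ξ → +∞, then φ'(ξ) < 0 for all ξ ∈ ℝ. -/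
open Filter

/-- For `c ≥ 2/√s`, every positive unbounded traveling wave of speed `c`
is strictly decreasing: `φ' < 0` everywhere. -/
theorem positive_unbounded_traveling_wave_strictly_decreasing
    (s c : ℝ) (hs : 0 < s) (hc : 2 / Real.sqrt s ≤ c)
    (φ : ℝ → ℝ)
    (hφ : ∀ ξ : ℝ, DifferentiableAt ℝ φ ξ)
    (hφ' : ∀ ξ : ℝ, DifferentiableAt ℝ (deriv φ) ξ)
    (hpos : ∀ ξ : ℝ, 0 < φ ξ)
    (hode : ∀ ξ : ℝ, deriv (deriv φ) ξ + c * deriv φ ξ + (φ ξ) ^ 3 / (1 + s * (φ ξ) ^ 2) = 0)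
    (hlim₁ : Tendsto φ atBot atTop)
    (hlim₂ : Tendsto φ atTop (nhds 0)) :
    ∀ ξ : ℝ, deriv φ ξ < 0 := by
  intro x0
  by_contra! h0
  -- the weighted derivative `exp (c ξ) φ'(ξ)` is nonincreasing
  have hg : ∀ x, HasDerivAt (fun x => Real.exp (c * x) * deriv φ x)
      (Real.exp (c * x) * (c * 1) * deriv φ x + Real.exp (c * x) * deriv (deriv φ) x) x :=
    fun x => (((hasDerivAt_id x).const_mul c).exp).mul (hφ' x).hasDerivAt
  have hanti : Antitone (fun x => Real.exp (c * x) * deriv φ x) := by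
    apply antitone_of_deriv_nonpos (fun x => (hg x).differentiableAt)
    intro x
    rw [(hg x).deriv]
    have h1 := hode x
    have h2 : 0 ≤ (φ x) ^ 3 / (1 + s * (φ x) ^ 2) := by
      have := hpos x
      positivity
    have h3 := Real.exp_pos (c * x)
    nlinarith
  have hd : ∀ x ≤ x0, 0 ≤ deriv φ x := by
    intro x hx
    have h1 := hanti hx
    have h2 : 0 ≤ Real.exp (c * x0) * deriv φ x0 := mul_nonneg (Real.exp_pos _).le h0
    exact nonneg_of_mul_nonneg_right (h2.trans h1) (Real.exp_pos _)
  have hmono : MonotoneOn φ (Set.Iic x0) := by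
    apply monotoneOn_of_deriv_nonneg (convex_Iic x0)
    · exact fun x _ => (hφ x).continuousAt.continuousWithinAt
    · exact fun x _ => (hφ x).differentiableWithinAt
    · intro x hx
      exact hd x (Set.mem_Iic.mp (interior_subset hx))
  obtain ⟨x, hx1, hx2⟩ :=
    ((hlim₁.eventually_gt_atTop (φ x0)).and (eventually_le_atBot x0)).exists
  exact absurd (hmono hx2 Set.self_mem_Iic hx2) (not_le.mpr hx1)
end

section
/- Let s > 0 and c > 0, and let G : ℝ² → ℝ² be the compactified (chart-U₁, desingularized) vector field G(λ₁, λ₂) = (-λ₁³λ₂ - s λ₁ λ₂, -c λ₁² λ₂ - c s λ₂ - 1 - λ₁² λ₂² - s λ₂²). Then for y ∈ ℝ one has G(0, y) = 0 if and only if s y² + c s y + 1 = 0, and the set E = {y ∈ ℝ : G(0,y) = 0} of equilibria at infinity satisfies the trichotomy: (i) if 0 < c < 2/√s then E = ∅; (ii) if c = 2/√s then E = {-1/√s}; (iii) if c > 2/√s then E = {M₋, M₊} with M₋ = (-cs - √(c²s² - 4s))/(2s), M₊ = (-cs + √(c²s² - 4s))/(2s), and M₋ < M₊ < 0. -/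
open Filter

/-- Equilibria at infinity of the compactified (chart-`U₁`, desingularized)
vector field `G`: `G(0,y) = 0 ↔ s y² + c s y + 1 = 0`, with the trichotomy in `c`
relatively to the critical speed `2/√s`. -/
theorem equilibria_at_infinity_trichotomy
    (s c : ℝ) (hs : 0 < s) (hc : 0 < c)
    (G : ℝ × ℝ → ℝ × ℝ)
    (hG : ∀ l1 l2 : ℝ, G (l1, l2) =
      (-l1 ^ 3 * l2 - s * l1 * l2,
       -c * l1 ^ 2 * l2 - c * s * l2 - 1 - l1 ^ 2 * l2 ^ 2 - s * l2 ^ 2)) :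
    (∀ y : ℝ, G (0, y) = 0 ↔ s * y ^ 2 + c * s * y + 1 = 0) ∧
    (c < 2 / Real.sqrt s → {y : ℝ | G (0, y) = 0} = ∅) ∧
    (c = 2 / Real.sqrt s → {y : ℝ | G (0, y) = 0} = {-1 / Real.sqrt s}) ∧
    (2 / Real.sqrt s < c →
      {y : ℝ | G (0, y) = 0} =
        {(-c * s - Real.sqrt (c ^ 2 * s ^ 2 - 4 * s)) / (2 * s),
         (-c * s + Real.sqrt (c ^ 2 * s ^ 2 - 4 * s)) / (2 * s)} ∧
      (-c * s - Real.sqrt (c ^ 2 * s ^ 2 - 4 * s)) / (2 * s) <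
        (-c * s + Real.sqrt (c ^ 2 * s ^ 2 - 4 * s)) / (2 * s) ∧
      (-c * s + Real.sqrt (c ^ 2 * s ^ 2 - 4 * s)) / (2 * s) < 0) := by
  have key : ∀ y : ℝ, G (0, y) = 0 ↔ s * y ^ 2 + c * s * y + 1 = 0 := by
    intro y
    rw [hG, Prod.ext_iff]
    simp only [Prod.fst_zero, Prod.snd_zero]
    constructor
    · rintro ⟨_, h⟩
      linarith
    · intro h
      constructor
      · ring
      · linarith
  have hr : 0 < Real.sqrt s := Real.sqrt_pos.mpr hs
  have hrs : Real.sqrt s ^ 2 = s := Real.sq_sqrt hs.le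
  refine ⟨key, ?_, ?_, ?_⟩
  · intro h
    rw [lt_div_iff₀ hr] at h
    ext y
    simp only [Set.mem_setOf_eq, key, Set.mem_empty_iff_false, iff_false]
    intro hy
    generalize Real.sqrt s = r at *
    subst hrs
    have hp : 0 < c * r := mul_pos hc hr
    have h4 : (c * r) ^ 2 < 4 := by nlinarith
    nlinarith [sq_nonneg (r * y + c * r / 2 * 1), sq_nonneg (2 * (r * y) + (c * r) * r)]
  · intro h
    rw [eq_div_iff hr.ne'] at h
    ext y
    simp only [Set.mem_setOf_eq, key, Set.mem_singleton_iff]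
    rw [eq_div_iff hr.ne']
    generalize Real.sqrt s = r at *
    subst hrs
    have e : r ^ 2 * y ^ 2 + c * r ^ 2 * y + 1 = (y * r + 1) ^ 2 := by
      linear_combination (r * y) * h
    rw [e, sq_eq_zero_iff]
    constructor <;> intro h <;> linarith
  · intro h
    rw [div_lt_iff₀ hr] at h
    have hD : 0 < c ^ 2 * s ^ 2 - 4 * s := by
      have h4 : 4 < c ^ 2 * s := by
        rw [← hrs]
        nlinarith
      nlinarith
    have hd := Real.sqrt_pos.mpr hD
    have hd2 := Real.sq_sqrt hD.le
    generalize Real.sqrt (c ^ 2 * s ^ 2 - 4 * s) = d at *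
    have h2s : 0 < 2 * s := by linarith
    refine ⟨?_, ?_, ?_⟩
    · ext y
      simp only [Set.mem_setOf_eq, key, Set.mem_insert_iff, Set.mem_singleton_iff]
      rw [eq_div_iff h2s.ne', eq_div_iff h2s.ne']
      have e : 4 * s * (s * y ^ 2 + c * s * y + 1)
          = (y * (2 * s) - (-c * s - d)) * (y * (2 * s) - (-c * s + d)) := by
        linear_combination hd2
      rw [← sub_eq_zero (a := y * (2 * s)), ← sub_eq_zero (a := y * (2 * s)) (b := -c * s + d),
        ← mul_eq_zero, ← e]
      simp [hs.ne']
    · rw [div_lt_div_iff_of_pos_right h2s]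
      linarith
    · apply div_neg_of_neg_of_pos _ h2s
      have : 0 < c * s := mul_pos hc hs
      nlinarith
end
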